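/- arXiv:math/0202038 — 3 statements merged into one kernel-verified Lean document; each statement's English description precedes it below -/
import Mathlib

section
/- Suppose 2 ≤ n − m and the complete intersection h₁ = ⋯ = hₘ = 0 has isolated singularities. Let {-,-} be a Poisson bracket on O = A/(h₁,…,hₘ) and let P be a prime ideal of O. Then for all u, v ∈ O, the element loc({u,v}) belongs to the ideal of O_P generated by the images under loc of the classes in O of the m×m minors of the Jacobian matrix (∂ⱼhᵢ). -/
open MvPolynomial

set_option synthInstance.maxHeartbeats 1000000
set_option maxHeartbeats 1000000

/-- A Poisson bracket on a commutative `ℂ`-algebra `R`: a `ℂ`-bilinear map which is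
antisymmetric, a derivation in each argument, and satisfies the Jacobi identity. -/
def IsPoissonBracket {R : Type*} [CommRing R] [Algebra ℂ R] (br : R → R → R) : Prop :=
  (∀ (c : ℂ) (f g k : R), br (c • f + g) k = c • br f k + br g k) ∧
  (∀ (c : ℂ) (f g k : R), br f (c • g + k) = c • br f g + br f k) ∧
  (∀ f g : R, br f g = - br g f) ∧
  (∀ f g k : R, br f (g * k) = br f g * k + g * br f k) ∧
  (∀ f g k : R, br (f * g) k = br f k * g + f * br g k) ∧
  (∀ f g k : R, br f (br g k) + br g (br k f) + br k (br f g) = 0)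

open CategoryTheory in
/-- An `Ext`-theoretic lower bound `d ≤ depth_I M`: the groups `Ext^i(R/I, M)` vanish for `i < d`. -/
def ExtDepthGE {R : Type} [CommRing R] (I : Ideal R) (d : ℕ)
    (M : Type) [AddCommGroup M] [Module R M] : Prop :=
  ∀ i < d, Subsingleton (Abelian.Ext (ModuleCat.of R (R ⧸ I)) (ModuleCat.of R M) i)

namespace ExtDepthGE

open CategoryTheory Abelian

variable {R : Type} [CommRing R] {I : Ideal R} {M₁ M₂ M₃ : Type}
  [AddCommGroup M₁] [Module R M₁] [AddCommGroup M₂] [Module R M₂] [AddCommGroup M₃] [Module R M₃]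

lemma mono {d e : ℕ} (h : ExtDepthGE I d M₁) (hed : e ≤ d) : ExtDepthGE I e M₁ :=
  fun i hi => h i (hi.trans_le hed)

lemma of_subsingleton [Subsingleton M₁] (d : ℕ) : ExtDepthGE I d M₁ := by
  intro i _
  have hz : Limits.IsZero (ModuleCat.of R M₁) := ModuleCat.isZero_of_subsingleton _
  refine ⟨fun x y => ?_⟩
  rw [← Ext.comp_mk₀_id x, ← Ext.comp_mk₀_id y, hz.eq_of_src (𝟙 _) 0]
  simp

section ShortExact

variable {f : M₁ →ₗ[R] M₂} {g : M₂ →ₗ[R] M₃}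

lemma shortExact_moduleCat (hf : Function.Injective f) (hg : Function.Surjective g)
    (hfg : Function.Exact f g) :
    (ModuleCat.shortComplexOfCompEqZero f g hfg.linearMap_comp_eq_zero).ShortExact where
  exact := ModuleCat.shortComplex_exact _ hfg
  mono_f := by simpa [ModuleCat.mono_iff_injective] using! hf
  epi_g := by simpa [ModuleCat.epi_iff_surjective] using! hg

lemma of_shortExact_middle {d : ℕ} (hf : Function.Injective f) (hg : Function.Surjective g)
    (hfg : Function.Exact f g) (h₁ : ExtDepthGE I d M₁) (h₃ : ExtDepthGE I d M₃) :
    ExtDepthGE I d M₂ := by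
  intro i hi
  have s₁ := h₁ i hi
  have s₃ := h₃ i hi
  have key : ∀ x : Ext (ModuleCat.of R (R ⧸ I)) (ModuleCat.of R M₂) i, x = 0 := by
    intro x
    obtain ⟨y, rfl⟩ := Ext.covariant_sequence_exact₂ _ (shortExact_moduleCat hf hg hfg) x
      (s₃.elim _ _)
    rw [s₁.elim y 0, Ext.zero_comp]
  exact ⟨fun x y => (key x).trans (key y).symm⟩

lemma of_linearEquiv {d : ℕ} (e : M₁ ≃ₗ[R] M₂) (h : ExtDepthGE I d M₁) : ExtDepthGE I d M₂ :=
  of_shortExact_middle (f := e.toLinearMap) (g := (0 : M₂ →ₗ[R] PUnit)) e.injective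
    (Function.surjective_to_subsingleton _) (fun y => by simp) h (of_subsingleton d)

lemma of_shortExact_right {d : ℕ} (hf : Function.Injective f) (hg : Function.Surjective g)
    (hfg : Function.Exact f g) (h₁ : ExtDepthGE I (d + 1) M₁) (h₂ : ExtDepthGE I d M₂) :
    ExtDepthGE I d M₃ := by
  intro i hi
  have s₁ := h₁ (i + 1) (by omega)
  have s₂ := h₂ i hi
  have key : ∀ x : Ext (ModuleCat.of R (R ⧸ I)) (ModuleCat.of R M₃) i, x = 0 := by
    intro x
    obtain ⟨y, rfl⟩ := Ext.covariant_sequence_exact₃ _ (shortExact_moduleCat hf hg hfg) x rfl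
      (s₁.elim _ _)
    rw [s₂.elim y 0, Ext.zero_comp]
  exact ⟨fun x y => (key x).trans (key y).symm⟩

end ShortExact

lemma pi_fin {d : ℕ} (h : ExtDepthGE I d M₁) (k : ℕ) : ExtDepthGE I d (Fin k → M₁) := by
  induction k with
  | zero => exact of_subsingleton d
  | succ k ih =>
    refine of_linearEquiv (Fin.consLinearEquiv R fun _ => M₁) ?_
    exact of_shortExact_middle (f := LinearMap.inl R M₁ (Fin k → M₁))
      (g := LinearMap.snd R M₁ (Fin k → M₁)) LinearMap.inl_injective Prod.snd_surjective
      Function.Exact.inl_snd h ih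

lemma of_free {d : ℕ} (h : ExtDepthGE I d R) [Module.Free R M₁] [Module.Finite R M₁] :
    ExtDepthGE I d M₁ := by
  have b := Module.Free.chooseBasis R M₁
  exact of_linearEquiv (b.reindex (Fintype.equivFin _)).equivFun.symm (pi_fin h _)

open scoped Pointwise in
lemma quotient_of_isWeaklyRegular (rs : List R) :
    ∀ {M : Type} [AddCommGroup M] [Module R M] {d : ℕ},
      RingTheory.Sequence.IsWeaklyRegular M rs → ExtDepthGE I (d + rs.length) M →
        ExtDepthGE I d (M ⧸ (Ideal.ofList rs • ⊤ : Submodule R M)) := by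
  induction rs with
  | nil =>
    intro M _ _ d _ h
    refine of_linearEquiv ?_ h
    exact (Submodule.quotEquivOfEqBot _ (by simp)).symm
  | cons r rs ih =>
    intro M _ _ d hreg h
    rw [RingTheory.Sequence.isWeaklyRegular_cons_iff] at hreg
    refine of_linearEquiv (Submodule.quotOfListConsSMulTopEquivQuotSMulTopInner M r rs).symm ?_
    refine ih hreg.2 ?_
    exact of_shortExact_right (f := LinearMap.lsmul R M r) (g := (r • (⊤ : Submodule R M)).mkQ)
      hreg.1 (Submodule.mkQ_surjective _) (LinearMap.exact_lsmul_mkQ_smul_top M r)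
      (h.mono (by simp +arith)) (h.mono (by simp))

lemma eq_zero_of_smul_eq_zero (h : ExtDepthGE I 1 M₁) {x : M₁} (hx : ∀ a ∈ I, a • x = 0) :
    x = 0 := by
  have s := h 0 one_pos
  have : Subsingleton ((R ⧸ I) →ₗ[R] M₁) :=
    ((Ext.addEquiv₀ (X := ModuleCat.of R (R ⧸ I)) (Y := ModuleCat.of R M₁)).trans
      ModuleCat.homAddEquiv).symm.subsingleton
  have hle : I ≤ LinearMap.ker (LinearMap.toSpanSingleton R M₁ x) := fun a ha => by
    simpa using hx a ha
  have h0 := LinearMap.congr_fun (this.elim (Submodule.liftQ I _ hle) 0) (Submodule.Quotient.mk 1)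
  rwa [Submodule.liftQ_apply, LinearMap.toSpanSingleton_apply, one_smul] at h0

lemma eq_zero_of_pow_smul_eq_zero [IsNoetherianRing R] {S : Set R} (hS : I = Ideal.span S)
    (h : ExtDepthGE I 1 M₁) {x : M₁} (hx : ∀ a ∈ S, ∃ k : ℕ, a ^ k • x = 0) : x = 0 := by
  have hrad : I ≤ Ideal.radical (LinearMap.ker (LinearMap.toSpanSingleton R M₁ x)) := by
    rw [hS, Ideal.span_le]
    intro a ha
    obtain ⟨k, hk⟩ := hx a ha
    exact ⟨k, by simpa using hk⟩
  obtain ⟨N, hN⟩ := Ideal.exists_pow_le_of_le_radical_of_fg hrad (IsNoetherian.noetherian I)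
  have key : ∀ j ≤ N, ∀ a ∈ I ^ (N - j), a • x = 0 := by
    intro j
    induction j with
    | zero => intro _ a ha; simpa using hN ha
    | succ j ih =>
      intro hj a ha
      refine h.eq_zero_of_smul_eq_zero fun b hb => ?_
      rw [smul_smul]
      refine ih (by omega) _ ?_
      rw [show N - j = N - (j + 1) + 1 by omega, pow_succ']
      exact Ideal.mul_mem_mul hb ha
  simpa using key N le_rfl 1 (by simp)

end ExtDepthGE

lemma isWeaklyRegular_map_ringEquiv {R S : Type*} [CommRing R] [CommRing S] (e : R ≃+* S)
    {rs : List R} (h : RingTheory.Sequence.IsWeaklyRegular R rs) :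
    RingTheory.Sequence.IsWeaklyRegular S (rs.map e) := by
  refine (AddEquiv.isWeaklyRegular_congr (e := e.toAddEquiv) ?_).mp h
  rw [List.forall₂_map_right_iff, List.forall₂_same]
  intro r _ x
  simp

lemma isWeaklyRegular_map_C_concat_monic {R : Type*} [CommRing R] {rs : List R}
    (h : RingTheory.Sequence.IsWeaklyRegular R rs) {q : Polynomial R} (hq : q.Monic) :
    RingTheory.Sequence.IsWeaklyRegular (Polynomial R) (rs.map Polynomial.C ++ [q]) := by
  rw [RingTheory.Sequence.isWeaklyRegular_append_iff]
  refine ⟨RingTheory.Sequence.IsWeaklyRegular.of_flat (S := Polynomial R) h, ?_⟩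
  rw [RingTheory.Sequence.isWeaklyRegular_singleton_iff, isSMulRegular_iff_right_eq_zero_of_smul]
  intro x hx
  obtain ⟨f, rfl⟩ := Submodule.Quotient.mk_surjective _ x
  rw [← Submodule.Quotient.mk_smul] at hx
  rw [Submodule.Quotient.mk_eq_zero] at hx ⊢
  rw [← Ideal.map_ofList Polynomial.C] at hx ⊢
  simp only [smul_eq_mul, Ideal.mul_top] at hx ⊢
  have hmem : ∀ g : Polynomial R, g ∈ (Ideal.ofList rs).map Polynomial.C ↔
      g.map (Ideal.Quotient.mk (Ideal.ofList rs)) = 0 := by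
    intro g
    rw [Ideal.mem_map_C_iff, Polynomial.ext_iff]
    simp [Ideal.Quotient.eq_zero_iff_mem]
  rw [hmem] at hx ⊢
  rw [Polynomial.map_mul] at hx
  exact ((hq.map _).isRegular.left.mul_left_eq_zero_iff).mp hx

lemma MvPolynomial.exists_isWeaklyRegular_aeval_X {K : Type*} [CommRing K] :
    ∀ (n : ℕ) (p : Fin n → Polynomial K), (∀ i, (p i).Monic) →
      ∃ rs : List (MvPolynomial (Fin n) K), rs.length = n ∧
        (∀ r ∈ rs, ∃ i, r = Polynomial.aeval (X i) (p i)) ∧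
        RingTheory.Sequence.IsWeaklyRegular (MvPolynomial (Fin n) K) rs := by
  intro n
  induction n with
  | zero => exact fun p _ => ⟨[], by simp⟩
  | succ n ih =>
    intro p hp
    obtain ⟨rs, hlen, hrs, hreg⟩ := ih (fun i => p i.succ) fun i => hp _
    let q : Polynomial (MvPolynomial (Fin n) K) := (p 0).map (algebraMap K _)
    refine ⟨(rs.map Polynomial.C ++ [q]).map (finSuccEquiv K n).symm.toRingEquiv, by simp [hlen],
      ?_, isWeaklyRegular_map_ringEquiv _
        (isWeaklyRegular_map_C_concat_monic hreg ((hp 0).map _))⟩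
    intro r hr
    simp only [List.map_append, List.map_map, List.map_cons, List.map_nil, List.mem_append,
      List.mem_map, List.mem_singleton] at hr
    rcases hr with ⟨a, ha, rfl⟩ | rfl
    · obtain ⟨i, rfl⟩ := hrs a ha
      refine ⟨i.succ, ?_⟩
      apply (finSuccEquiv K n).injective
      have h1 : (finSuccEquiv K n) ((finSuccEquiv K n).symm.toRingEquiv
          (Polynomial.C (Polynomial.aeval (X i) (p i.succ)))) =
          Polynomial.C (Polynomial.aeval (X i) (p i.succ)) := (finSuccEquiv K n).apply_symm_apply _
      rw [Function.comp_apply, h1]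
      refine Eq.trans ?_ (Polynomial.aeval_algHom_apply (finSuccEquiv K n).toAlgHom (X i.succ)
        (p i.succ))
      rw [AlgEquiv.coe_toAlgHom, finSuccEquiv_X_succ]
      exact (Polynomial.aeval_algebraMap_apply _ (X i) (p i.succ)).symm
    · refine ⟨0, ?_⟩
      apply (finSuccEquiv K n).injective
      have h1 : (finSuccEquiv K n) ((finSuccEquiv K n).symm.toRingEquiv q) = q :=
        (finSuccEquiv K n).apply_symm_apply _
      rw [h1, ← AlgEquiv.coe_toAlgHom, ← Polynomial.aeval_algHom_apply, AlgEquiv.coe_toAlgHom,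
        finSuccEquiv_X_zero, Polynomial.aeval_def, IsScalarTower.algebraMap_eq K
        (MvPolynomial (Fin n) K) (Polynomial (MvPolynomial (Fin n) K)), ← Polynomial.eval₂_map]
      exact Polynomial.eval₂_C_X.symm

/-- The submodule `∑_{i < k} d i (L (p + 1))` generated by the images of the first `k` of the
operators `d i`. -/
def partialBoundaries {R Λ : Type*} [CommRing R] [AddCommGroup Λ] [Module R Λ]
    (L : ℕ → Submodule R Λ) (d : ℕ → Module.End R Λ) : ℕ → ℕ → Submodule R Λ
  | 0, _ => ⊥
  | k + 1, p => partialBoundaries L d k p ⊔ (L (p + 1)).map (d k)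

/-- The composite `d 0 ∘ d 1 ∘ ⋯ ∘ d (k - 1)`. -/
def iteratedOperator {R Λ : Type*} [CommRing R] [AddCommGroup Λ] [Module R Λ]
    (d : ℕ → Module.End R Λ) : ℕ → Module.End R Λ
  | 0 => LinearMap.id
  | k + 1 => iteratedOperator d k ∘ₗ d k

section AnticommutingOperators

variable {R Λ : Type} [CommRing R] [AddCommGroup Λ] [Module R Λ]
  {L : ℕ → Submodule R Λ} {d e : ℕ → Module.End R Λ} {a : R} {m : ℕ}

lemma map_mem_partialBoundaries (hd : ∀ i p, ∀ x ∈ L (p + 1), d i x ∈ L p)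
    (hdd : ∀ i j x, d i (d j x) = -d j (d i x)) (j : ℕ) {k p : ℕ} {x : Λ}
    (hx : x ∈ partialBoundaries L d k (p + 1)) : d j x ∈ partialBoundaries L d k p := by
  induction k generalizing x with
  | zero =>
    rw [show x = 0 from hx, map_zero]
    exact zero_mem _
  | succ k ih =>
    obtain ⟨y, hy, z, ⟨w, hw, rfl⟩, rfl⟩ := Submodule.mem_sup.mp hx
    rw [map_add, hdd]
    exact Submodule.add_mem_sup (ih hy) (neg_mem (Submodule.mem_map_of_mem (hd _ _ _ hw)))

lemma raise_mem_partialBoundaries (he : ∀ i p, ∀ x ∈ L p, e i x ∈ L (p + 1))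
    (hne : ∀ i j, i ≠ j → ∀ x, e i (d j x) = -d j (e i x)) {j k p : ℕ} (hjk : k ≤ j) {x : Λ}
    (hx : x ∈ partialBoundaries L d k p) : e j x ∈ partialBoundaries L d k (p + 1) := by
  induction k generalizing x with
  | zero =>
    rw [show x = 0 from hx, map_zero]
    exact zero_mem _
  | succ k ih =>
    obtain ⟨y, hy, z, ⟨w, hw, rfl⟩, rfl⟩ := Submodule.mem_sup.mp hx
    rw [map_add, hne _ _ (by omega)]
    exact Submodule.add_mem_sup (ih (by omega) hy)
      (neg_mem (Submodule.mem_map_of_mem (he _ _ _ hw)))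

lemma smul_mem_partialBoundaries (he : ∀ i p, ∀ x ∈ L p, e i x ∈ L (p + 1))
    (hne : ∀ i j, i ≠ j → ∀ x, e i (d j x) = -d j (e i x))
    (heq : ∀ i < m, ∀ x, e i (d i x) + d i (e i x) = a • x) {k p : ℕ} (hk : k < m) {x : Λ}
    (hx : x ∈ L (p + 1)) (hdx : d k x ∈ partialBoundaries L d k p) :
    a • x ∈ partialBoundaries L d (k + 1) (p + 1) := by
  rw [← heq k hk]
  exact Submodule.add_mem_sup (raise_mem_partialBoundaries he hne le_rfl hdx)
    (Submodule.mem_map_of_mem (he _ _ _ hx))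

lemma iteratedOperator_mem (hd : ∀ i p, ∀ x ∈ L (p + 1), d i x ∈ L p) (k p : ℕ) {x : Λ}
    (hx : x ∈ L (p + k)) : iteratedOperator d k x ∈ L p := by
  induction k generalizing x with
  | zero => exact hx
  | succ k ih => exact ih (hd _ _ _ hx)

lemma iteratedOperator_apply_eq_zero (hd0 : ∀ i x, d i (d i x) = 0)
    (hdd : ∀ i j x, d i (d j x) = -d j (d i x)) {i k : ℕ} (hik : i < k) (x : Λ) :
    iteratedOperator d k (d i x) = 0 := by
  induction k generalizing x with
  | zero => omega
  | succ k ih =>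
    change iteratedOperator d k (d k (d i x)) = 0
    rcases (Nat.lt_succ_iff_lt_or_eq.mp hik) with h | rfl
    · rw [hdd, map_neg, ih h, neg_zero]
    · rw [hd0, map_zero]

lemma iteratedOperator_eq_zero_of_mem (hd0 : ∀ i x, d i (d i x) = 0)
    (hdd : ∀ i j x, d i (d j x) = -d j (d i x)) {l k p : ℕ} (hlk : l ≤ k) {x : Λ}
    (hx : x ∈ partialBoundaries L d l p) : iteratedOperator d k x = 0 := by
  induction l generalizing x with
  | zero => rw [show x = 0 from hx, map_zero]
  | succ l ih =>
    obtain ⟨y, hy, z, ⟨w, hw, rfl⟩, rfl⟩ := Submodule.mem_sup.mp hx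
    rw [map_add, ih (by omega) hy, iteratedOperator_apply_eq_zero hd0 hdd (by omega), add_zero]

lemma pow_smul_mem_partialBoundaries (hd : ∀ i p, ∀ x ∈ L (p + 1), d i x ∈ L p)
    (he : ∀ i p, ∀ x ∈ L p, e i x ∈ L (p + 1))
    (hne : ∀ i j, i ≠ j → ∀ x, e i (d j x) = -d j (e i x))
    (heq : ∀ i < m, ∀ x, e i (d i x) + d i (e i x) = a • x) {k p : ℕ} (hk : k ≤ m) {x : Λ}
    (hx : x ∈ L (p + k)) (h0 : iteratedOperator d k x = 0) :
    a ^ k • x ∈ partialBoundaries L d k (p + k) := by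
  induction k generalizing x with
  | zero => simpa [partialBoundaries, iteratedOperator] using h0
  | succ k ih =>
    have h1 := ih (by omega) (hd k _ _ hx) h0
    rw [← map_smul] at h1
    rw [pow_succ', mul_smul]
    exact smul_mem_partialBoundaries he hne heq (by omega) (Submodule.smul_mem _ _ hx) h1

lemma exists_pow_smul_eq_iteratedOperator (he : ∀ i p, ∀ x ∈ L p, e i x ∈ L (p + 1))
    (hne : ∀ i j, i ≠ j → ∀ x, e i (d j x) = -d j (e i x))
    (heq : ∀ i < m, ∀ x, e i (d i x) + d i (e i x) = a • x) {p : ℕ} {w : Λ}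
    (hw : w ∈ L p) (hdw : ∀ i < m, d i w = 0) {k : ℕ} (hk : k ≤ m) :
    ∃ y ∈ L (p + k), (∀ i < m, k ≤ i → d i y = 0) ∧ a ^ k • w = iteratedOperator d k y := by
  induction k with
  | zero => exact ⟨w, hw, fun i hi _ => hdw i hi, by simp [iteratedOperator]⟩
  | succ k ih =>
    obtain ⟨y, hy, hdy, hwy⟩ := ih (by omega)
    refine ⟨e k y, he _ _ _ hy, fun i hi hki => ?_, ?_⟩
    · have := hne k i (by omega) y
      rwa [hdy i hi (by omega), map_zero, eq_comm, neg_eq_zero] at this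
    · have := heq k (by omega) y
      rw [hdy k (by omega) le_rfl, map_zero, zero_add] at this
      change _ = iteratedOperator d k (d k (e k y))
      rw [this, map_smul, ← hwy, pow_succ', mul_smul]

variable [IsNoetherianRing R] {S : Set R} {n D : ℕ}

lemma extDepthGE_quotient_partialBoundaries {e : R → ℕ → Module.End R Λ}
    (hL : ∀ p, ExtDepthGE (Ideal.span S) D (L p)) (hLn : ∀ p, n < p → L p = ⊥)
    (hd : ∀ i p, ∀ x ∈ L (p + 1), d i x ∈ L p)
    (hd0 : ∀ i x, d i (d i x) = 0)
    (hdd : ∀ i j x, d i (d j x) = -d j (d i x))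
    (he : ∀ a ∈ S, ∀ i p, ∀ x ∈ L p, e a i x ∈ L (p + 1))
    (hne : ∀ a ∈ S, ∀ i j, i ≠ j → ∀ x, e a i (d j x) = -d j (e a i x))
    (heq : ∀ a ∈ S, ∀ i < m, ∀ x, e a i (d i x) + d i (e a i x) = a • x)
    {k : ℕ} (hk : k ≤ m) {p c : ℕ} (hc : c + n ≤ D + p) :
    ExtDepthGE (Ideal.span S) c (L p ⧸ (partialBoundaries L d k p).submoduleOf (L p)) := by
  have vanish : ∀ k p c, n < p →
      ExtDepthGE (Ideal.span S) c (L p ⧸ (partialBoundaries L d k p).submoduleOf (L p)) := by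
    intro k p c hp
    have : Subsingleton (L p) := by rw [hLn p hp]; infer_instance
    have : Subsingleton (L p ⧸ (partialBoundaries L d k p).submoduleOf (L p)) :=
      (Submodule.mkQ_surjective _).subsingleton
    exact ExtDepthGE.of_subsingleton c
  induction k generalizing p c with
  | zero =>
    by_cases hp : n < p
    · exact vanish _ _ _ hp
    refine ExtDepthGE.of_linearEquiv ?_ ((hL p).mono (e := c) (by omega))
    exact (Submodule.quotEquivOfEqBot _ (by simp [partialBoundaries, Submodule.submoduleOf])).symm
  | succ k ih =>
    obtain ⟨t, ht⟩ : ∃ t, n + 1 ≤ p + t := ⟨n + 1, by omega⟩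
    induction t generalizing p c with
    | zero => exact vanish _ _ _ (by omega)
    | succ t iht =>
      have h₁ := iht (p := p + 1) (c := c + 1) (by omega) (by omega)
      have h₂ := ih (by omega) hc
      have hle : (partialBoundaries L d (k + 1) (p + 1)).submoduleOf (L (p + 1)) ≤
          ((partialBoundaries L d k p).submoduleOf (L p)).comap ((d k).restrict (hd k p)) := by
        rintro ⟨x, hx⟩ hxB
        change d k x ∈ partialBoundaries L d k p
        obtain ⟨y, hy, z, ⟨w, hw, rfl⟩, hyz⟩ := Submodule.mem_sup.mp hxB
        change y + d k w = x at hyz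
        rw [← hyz, map_add, hd0, add_zero]
        exact map_mem_partialBoundaries hd hdd k hy
      have hle' : (partialBoundaries L d k p).submoduleOf (L p) ≤
          (partialBoundaries L d (k + 1) p).submoduleOf (L p) :=
        Submodule.comap_mono le_sup_left
      refine ExtDepthGE.of_shortExact_right (f := Submodule.mapQ _ _ _ hle)
        (g := Submodule.factor hle') ?_ (Submodule.factor_surjective hle') ?_ h₁ h₂
      · rw [← LinearMap.ker_eq_bot, LinearMap.ker_eq_bot']
        intro x hx
        obtain ⟨x, rfl⟩ := Submodule.Quotient.mk_surjective _ x
        rw [Submodule.mapQ_apply, Submodule.Quotient.mk_eq_zero] at hx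
        refine ExtDepthGE.eq_zero_of_pow_smul_eq_zero rfl (h₁.mono (by omega)) fun a ha => ⟨1, ?_⟩
        rw [pow_one, ← Submodule.Quotient.mk_smul, Submodule.Quotient.mk_eq_zero]
        exact smul_mem_partialBoundaries (he a ha) (hne a ha) (heq a ha) (by omega) x.2 hx
      · intro x
        obtain ⟨⟨x, hxL⟩, rfl⟩ := Submodule.Quotient.mk_surjective _ x
        constructor
        · intro hx
          have hx : Submodule.Quotient.mk (p := (partialBoundaries L d (k + 1) p).submoduleOf (L p))
            (⟨x, hxL⟩ : L p) = 0 := hx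
          rw [Submodule.Quotient.mk_eq_zero] at hx
          obtain ⟨y, hy, z, ⟨w, hw, rfl⟩, hyz⟩ := Submodule.mem_sup.mp hx
          refine ⟨Submodule.Quotient.mk ⟨w, hw⟩, ?_⟩
          rw [Submodule.mapQ_apply, eq_comm, Submodule.Quotient.eq]
          change x - d k w ∈ partialBoundaries L d k p
          change y + d k w = x at hyz
          rwa [← hyz, add_sub_cancel_right]
        · rintro ⟨y, hy⟩
          obtain ⟨⟨y, hyL⟩, rfl⟩ := Submodule.Quotient.mk_surjective _ y
          rw [← hy]
          refine (Submodule.Quotient.mk_eq_zero _).mpr ?_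
          exact Submodule.mem_sup_right (Submodule.mem_map_of_mem hyL)

lemma mem_range_iteratedOperator {e : R → ℕ → Module.End R Λ}
    (hL : ∀ p, ExtDepthGE (Ideal.span S) D (L p)) (hLn : ∀ p, n < p → L p = ⊥)
    (hd : ∀ i p, ∀ x ∈ L (p + 1), d i x ∈ L p)
    (hd0 : ∀ i x, d i (d i x) = 0)
    (hdd : ∀ i j x, d i (d j x) = -d j (d i x))
    (he : ∀ a ∈ S, ∀ i p, ∀ x ∈ L p, e a i x ∈ L (p + 1))
    (hne : ∀ a ∈ S, ∀ i j, i ≠ j → ∀ x, e a i (d j x) = -d j (e a i x))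
    (heq : ∀ a ∈ S, ∀ i < m, ∀ x, e a i (d i x) + d i (e a i x) = a • x)
    (hD : 2 ≤ D) (hDn : n ≤ D + m) {w : Λ} (hw : w ∈ L 2) (hdw : ∀ i < m, d i w = 0) :
    ∃ y, w = iteratedOperator d m y := by
  have hM := extDepthGE_quotient_partialBoundaries hL hLn hd hd0 hdd he hne heq le_rfl
    (p := 2 + m) (c := 2) (by omega)
  let Φ : L (2 + m) →ₗ[R] L 2 :=
    (iteratedOperator d m).restrict fun x hx => iteratedOperator_mem hd m 2 hx
  have hle : (partialBoundaries L d m (2 + m)).submoduleOf (L (2 + m)) ≤ LinearMap.ker Φ := by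
    intro x hx
    exact Subtype.ext (iteratedOperator_eq_zero_of_mem hd0 hdd le_rfl hx)
  have hQ : ExtDepthGE (Ideal.span S) 1 (L 2 ⧸ LinearMap.range (Submodule.liftQ _ Φ hle)) := by
    refine ExtDepthGE.of_shortExact_right (f := Submodule.liftQ _ Φ hle)
      (g := (LinearMap.range (Submodule.liftQ _ Φ hle)).mkQ) ?_ (Submodule.mkQ_surjective _)
      (LinearMap.exact_map_mkQ_range _) hM ((hL 2).mono (by omega))
    rw [← LinearMap.ker_eq_bot, LinearMap.ker_eq_bot']
    intro x hx
    obtain ⟨x, rfl⟩ := Submodule.Quotient.mk_surjective _ x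
    rw [Submodule.liftQ_apply] at hx
    refine ExtDepthGE.eq_zero_of_pow_smul_eq_zero rfl (hM.mono (by omega)) fun a ha => ⟨m, ?_⟩
    rw [← Submodule.Quotient.mk_smul, Submodule.Quotient.mk_eq_zero]
    exact pow_smul_mem_partialBoundaries hd (he a ha) (hne a ha) (heq a ha) le_rfl x.2
      (congrArg Subtype.val hx)
  have hw0 : Submodule.Quotient.mk (p := LinearMap.range (Submodule.liftQ _ Φ hle))
      (⟨w, hw⟩ : L 2) = 0 := by
    refine ExtDepthGE.eq_zero_of_pow_smul_eq_zero rfl hQ fun a ha => ⟨m, ?_⟩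
    rw [← Submodule.Quotient.mk_smul, Submodule.Quotient.mk_eq_zero]
    obtain ⟨y, hy, -, hwy⟩ :=
      exists_pow_smul_eq_iteratedOperator (he a ha) (hne a ha) (heq a ha) hw hdw le_rfl
    exact ⟨Submodule.Quotient.mk ⟨y, hy⟩, Subtype.ext hwy.symm⟩
  rw [Submodule.Quotient.mk_eq_zero] at hw0
  obtain ⟨y, hy⟩ := hw0
  obtain ⟨y, rfl⟩ := Submodule.Quotient.mk_surjective _ y
  exact ⟨y, (congrArg Subtype.val hy).symm⟩

end AnticommutingOperators

section ExteriorAlgebra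

open CliffordAlgebra ExteriorAlgebra

lemma exteriorPower_eq_bot_of_lt {R : Type} [CommRing R] {n p : ℕ} (hp : n < p) :
    ⋀[R]^p (Fin n → R) = ⊥ := by
  have : IsEmpty (Set.powersetCard (Fin n) p) := by
    refine ⟨fun s => ?_⟩
    have hs := s.2
    have := Finset.card_le_univ s.1
    rw [Set.powersetCard.mem_iff] at hs
    simp only [Fintype.card_fin] at this
    omega
  rw [← Submodule.subsingleton_iff_eq_bot]
  exact ((Pi.basisFun R (Fin n)).exteriorPower p).repr.toEquiv.subsingleton

lemma ExtDepthGE.exteriorPower {R : Type} [CommRing R] {I : Ideal R} {d : ℕ}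
    (h : ExtDepthGE I d R) (n p : ℕ) : ExtDepthGE I d (⋀[R]^p (Fin n → R)) := by
  have b := (Pi.basisFun R (Fin n)).exteriorPower p
  have := Module.Free.of_basis b
  have := Module.Finite.of_basis b
  exact ExtDepthGE.of_free h

variable {R M : Type*} [CommRing R] [AddCommGroup M] [Module R M]

/-- The interior product by a linear form, as an endomorphism of the exterior algebra. -/
noncomputable def interiorProduct (θ : Module.Dual R M) : Module.End R (ExteriorAlgebra R M) :=
  contractLeft (Q := (0 : QuadraticForm R M)) θ

lemma interiorProduct_ι_mul (θ : Module.Dual R M) (v : M) (x : ExteriorAlgebra R M) :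
    interiorProduct θ (ExteriorAlgebra.ι R v * x) =
      θ v • x - ExteriorAlgebra.ι R v * interiorProduct θ x :=
  contractLeft_ι_mul θ v x

lemma interiorProduct_ι (θ : Module.Dual R M) (v : M) :
    interiorProduct θ (ExteriorAlgebra.ι R v) = algebraMap R _ (θ v) :=
  contractLeft_ι _ θ v

lemma interiorProduct_self (θ : Module.Dual R M) (x : ExteriorAlgebra R M) :
    interiorProduct θ (interiorProduct θ x) = 0 :=
  contractLeft_contractLeft θ x

lemma interiorProduct_comm (θ θ' : Module.Dual R M) (x : ExteriorAlgebra R M) :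
    interiorProduct θ (interiorProduct θ' x) = -interiorProduct θ' (interiorProduct θ x) :=
  contractLeft_comm θ θ' x

lemma ι_mul_mem_exteriorPower (v : M) {p : ℕ} {x : ExteriorAlgebra R M} (hx : x ∈ ⋀[R]^p M) :
    ExteriorAlgebra.ι R v * x ∈ ⋀[R]^(p + 1) M := by
  rw [exteriorPower, pow_succ']
  exact Submodule.mul_mem_mul ⟨v, rfl⟩ hx

lemma interiorProduct_mem (θ : Module.Dual R M) :
    ∀ (p : ℕ) {x : ExteriorAlgebra R M}, x ∈ ⋀[R]^(p + 1) M → interiorProduct θ x ∈ ⋀[R]^p M := by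
  intro p
  induction p with
  | zero =>
    intro x hx
    rw [zero_add, exteriorPower, pow_one] at hx
    obtain ⟨v, rfl⟩ := hx
    rw [interiorProduct_ι, exteriorPower, pow_zero]
    exact Submodule.algebraMap_mem _
  | succ p ih =>
    intro x hx
    rw [exteriorPower, pow_succ'] at hx
    refine Submodule.mul_induction_on hx ?_ fun a b ha hb => by
      rw [map_add]; exact Submodule.add_mem _ ha hb
    rintro _ ⟨v, rfl⟩ y hy
    rw [interiorProduct_ι_mul]
    refine Submodule.sub_mem _ (Submodule.smul_mem _ _ hy) ?_
    exact ι_mul_mem_exteriorPower v (ih hy)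

/-- The interior products by linear forms, as an algebra map out of the exterior algebra of the
dual module. -/
noncomputable def interiorProductHom (R M : Type*) [CommRing R] [AddCommGroup M] [Module R M] :
    ExteriorAlgebra R (Module.Dual R M) →ₐ[R] Module.End R (ExteriorAlgebra R M) :=
  ExteriorAlgebra.lift R ⟨contractLeft (Q := (0 : QuadraticForm R M)),
    fun θ => LinearMap.ext fun x => interiorProduct_self θ x⟩

lemma interiorProductHom_ι (θ : Module.Dual R M) :
    interiorProductHom R M (ExteriorAlgebra.ι R θ) = interiorProduct θ :=
  ExteriorAlgebra.lift_ι_apply _ _ _ _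

lemma iteratedOperator_interiorProduct (θ : ℕ → Module.Dual R M) (m : ℕ) :
    iteratedOperator (fun i => interiorProduct (θ i)) m =
      interiorProductHom R M (ExteriorAlgebra.ιMulti R m fun i => θ i) := by
  induction m with
  | zero => simp [iteratedOperator]; rfl
  | succ m ih =>
    rw [iteratedOperator, ih, ExteriorAlgebra.ιMulti_apply, ExteriorAlgebra.ιMulti_apply,
      List.ofFn_succ', List.concat_eq_append, List.prod_append, map_mul, List.prod_singleton,
      interiorProductHom_ι]
    rfl

lemma AlternatingMap.apply_mem_smul_top_of_minors {N : Type*} [AddCommGroup N] [Module R N]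
    {m : ℕ} {ι : Type*} [LinearOrder ι] (b : Module.Basis ι R M)
    (f : M [⋀^Fin m]→ₗ[R] N) (v : Fin m → M) {J : Ideal R}
    (hJ : ∀ c : Fin m → ι, (Matrix.of fun i j => b.coord (c j) (v i)).det ∈ J) :
    f v ∈ (J • ⊤ : Submodule R N) := by
  rw [← exteriorPower.alternatingMapLinearEquiv_apply_ιMulti f v,
    ← (b.exteriorPower m).linearCombination_repr (exteriorPower.ιMulti R m v),
    Finsupp.linearCombination_apply, Finsupp.sum, map_sum]
  refine Submodule.sum_mem _ fun s _ => ?_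
  rw [map_smul, exteriorPower.basis_repr_apply, exteriorPower.ιMultiDual_apply_ιMulti]
  exact Submodule.smul_mem_smul (hJ _) trivial

lemma apply_iteratedOperator_interiorProduct_mem {ι : Type*} [LinearOrder ι]
    (b : Module.Basis ι R (Module.Dual R M)) (θ : ℕ → Module.Dual R M) {m : ℕ} {J : Ideal R}
    (hJ : ∀ c : Fin m → ι, (Matrix.of fun i j => b.coord (c j) (θ (i : Fin m))).det ∈ J)
    (l : ExteriorAlgebra R M →ₗ[R] R) (y : ExteriorAlgebra R M) :
    l (iteratedOperator (fun i => interiorProduct (θ i)) m y) ∈ J := by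
  have h := AlternatingMap.apply_mem_smul_top_of_minors b
    (((l ∘ₗ LinearMap.applyₗ y) ∘ₗ (interiorProductHom R M).toLinearMap).compAlternatingMap
      (ExteriorAlgebra.ιMulti R m)) (fun i => θ i) hJ
  rw [iteratedOperator_interiorProduct]
  rw [Ideal.smul_eq_mul, Ideal.mul_top] at h
  exact h

/-- The bivector `∑ π k l • e_k ∧ e_l`. -/
noncomputable def bivector {n : ℕ} (π : Fin n → Fin n → R) : ExteriorAlgebra R (Fin n → R) :=
  ∑ k, ∑ l, π k l • (ExteriorAlgebra.ι R (Pi.single k 1) * ExteriorAlgebra.ι R (Pi.single l 1))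

lemma bivector_mem {n : ℕ} (π : Fin n → Fin n → R) : bivector π ∈ ⋀[R]^2 (Fin n → R) := by
  refine Submodule.sum_mem _ fun k _ => Submodule.sum_mem _ fun l _ => Submodule.smul_mem _ _ ?_
  refine ι_mul_mem_exteriorPower _ ?_
  rw [exteriorPower, pow_one]
  exact ⟨_, rfl⟩

lemma interiorProduct_bivector {n : ℕ} {π : Fin n → Fin n → R} (hπ : ∀ k l, π k l = -π l k)
    (θ : Module.Dual R (Fin n → R)) :
    interiorProduct θ (bivector π) =
      -(2 : R) • ∑ k, (∑ l, π k l * θ (Pi.single l 1)) • ExteriorAlgebra.ι R (Pi.single k 1) := by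
  have h1 : interiorProduct θ (bivector π) =
      ∑ k, ∑ l, (π k l * θ (Pi.single k 1)) • ExteriorAlgebra.ι R (Pi.single l 1) -
      ∑ k, ∑ l, (π k l * θ (Pi.single l 1)) • ExteriorAlgebra.ι R (Pi.single k 1) := by
    simp only [bivector, map_sum, map_smul, interiorProduct_ι_mul, interiorProduct_ι,
      ← Finset.sum_sub_distrib, smul_sub, mul_smul, ← Algebra.commutes, ← Algebra.smul_def]
  rw [h1, Finset.sum_comm]
  simp only [Finset.sum_smul, Finset.smul_sum, ← Finset.sum_sub_distrib]
  refine Finset.sum_congr rfl fun k _ => Finset.sum_congr rfl fun l _ => ?_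
  rw [hπ l k]
  module

lemma algebraMapInv_interiorProduct_bivector {n : ℕ} {π : Fin n → Fin n → R}
    (hπ : ∀ k l, π k l = -π l k) (i j : Fin n) :
    ExteriorAlgebra.algebraMapInv (interiorProduct (LinearMap.proj i)
      (interiorProduct (LinearMap.proj j) (bivector π))) = -2 * π i j := by
  rw [interiorProduct_bivector hπ]
  simp only [map_smul, map_sum, interiorProduct_ι, LinearMap.proj_apply, Pi.single_apply]
  simp

end ExteriorAlgebra

lemma exists_smul_dual_family {R : Type*} [CommRing R] {n m : ℕ} (T : Fin m → Fin n → R)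
    (c : Fin m → Fin n) :
    ∃ ξ : Fin m → Fin n → R, ∀ i j, Fintype.linearCombination R (T j) (ξ i) =
      if i = j then (Matrix.of fun i j => T i (c j)).det else 0 := by
  set U := Matrix.of fun i j => T i (c j)
  refine ⟨fun i => ∑ j, U.adjugate j i • Pi.single (c j) 1, fun i j => ?_⟩
  have h := congr_fun (congr_fun U.mul_adjugate j) i
  rw [Matrix.mul_apply, Matrix.smul_apply, Matrix.one_apply, smul_eq_mul, mul_ite, mul_one,
    mul_zero] at h
  simp only [eq_comm (a := i), ← h, map_sum, map_smul, Fintype.linearCombination_apply_single,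
    smul_eq_mul, one_mul]
  exact Finset.sum_congr rfl fun k _ => mul_comm _ _

theorem mem_span_minors_of_sum_mul_eq_zero {R : Type} [CommRing R] [IsNoetherianRing R]
    (h2 : IsUnit (2 : R)) {n m D : ℕ} (T : Fin m → Fin n → R)
    (hdepth : ExtDepthGE (Ideal.span (Set.range fun c : Fin m → Fin n =>
      (Matrix.of fun i j => T i (c j)).det)) D R)
    (hD : 2 ≤ D) (hDn : n ≤ D + m) {π : Fin n → Fin n → R} (hπ : ∀ k l, π k l = -π l k)
    (hT : ∀ i k, ∑ l, π k l * T i l = 0) (k l : Fin n) :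
    π k l ∈ Ideal.span (Set.range fun c : Fin m → Fin n =>
      (Matrix.of fun i j => T i (c j)).det) := by
  set S := Set.range fun c : Fin m → Fin n => (Matrix.of fun i j => T i (c j)).det with hS
  let θ : ℕ → Module.Dual R (Fin n → R) := fun i =>
    if h : i < m then Fintype.linearCombination R (T ⟨i, h⟩) else 0
  have hθ : ∀ i : Fin m, θ i = Fintype.linearCombination R (T i) := fun i => by simp [θ]
  have hθ' : ∀ i, ¬ i < m → θ i = 0 := fun i hi => by simp [θ, hi]
  have hξ : ∀ a ∈ S, ∃ ξ : ℕ → Fin n → R, ∀ i j,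
      θ j (ξ i) = if i = j ∧ i < m then a else 0 := by
    rintro a ⟨c, rfl⟩
    obtain ⟨ξ, hξ⟩ := exists_smul_dual_family T c
    refine ⟨fun i => if h : i < m then ξ ⟨i, h⟩ else 0, fun i j => ?_⟩
    by_cases hi : i < m
    · by_cases hj : j < m
      · have := hξ ⟨i, hi⟩ ⟨j, hj⟩
        simp only [Fin.mk.injEq] at this
        simpa [hi, hj, θ] using this
      · have : i ≠ j := by omega
        simp [hθ' j hj, this]
    · simp [hi]
  choose! ξ hξ using hξ
  obtain ⟨y, hy⟩ := mem_range_iteratedOperator (S := S) (n := n) (D := D) (m := m)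
    (L := fun p => ⋀[R]^p (Fin n → R)) (d := fun i => interiorProduct (θ i))
    (e := fun a i => LinearMap.mulLeft R (ExteriorAlgebra.ι R (ξ a i)))
    (fun p => hdepth.exteriorPower n p) (fun p hp => exteriorPower_eq_bot_of_lt hp)
    (fun i p x hx => interiorProduct_mem (θ i) p hx)
    (fun i x => interiorProduct_self (θ i) x)
    (fun i j x => interiorProduct_comm (θ i) (θ j) x)
    (fun a _ i p x hx => ι_mul_mem_exteriorPower (ξ a i) hx)
    (fun a ha i j hij x => by
      simp [interiorProduct_ι_mul, hξ a ha i j, hij])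
    (fun a ha i hi x => by
      simp [interiorProduct_ι_mul, hξ a ha i i, hi])
    hD hDn (bivector_mem π)
    (fun i hi => by
      have := hθ ⟨i, hi⟩
      simp only at this
      simp [interiorProduct_bivector hπ, this, Fintype.linearCombination_apply_single, hT])
  have hmem := apply_iteratedOperator_interiorProduct_mem
    (Pi.basisFun R (Fin n)).dualBasis θ (m := m) (J := Ideal.span S)
    (fun c => by
      refine Ideal.subset_span ⟨c, congrArg Matrix.det (Matrix.ext fun i j => ?_)⟩
      simp [hθ, Fintype.linearCombination_apply_single])
    (ExteriorAlgebra.algebraMapInv.toLinearMap ∘ₗ interiorProduct (LinearMap.proj k) ∘ₗ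
      interiorProduct (LinearMap.proj l)) y
  rw [← hy] at hmem
  have h := algebraMapInv_interiorProduct_bivector hπ k l
  simp only [LinearMap.comp_apply, AlgHom.toLinearMap_apply, h] at hmem
  exact (Ideal.unit_mul_mem_iff_mem _ h2.neg).mp hmem

lemma ExtDepthGE.of_isWeaklyRegular {R : Type} [CommRing R] [IsNoetherianRing R] {I : Ideal R}
    {M : Type} [AddCommGroup M] [Module R M] [Module.Finite R M]
    (hI : (I • ⊤ : Submodule R M) < ⊤) {rs : List R} (hrs : ∀ r ∈ rs, r ∈ I)
    (h : RingTheory.Sequence.IsWeaklyRegular M rs) : ExtDepthGE I rs.length M := by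
  have hle : Ideal.ofList rs ≤ I := Ideal.span_le.mpr hrs
  refine fun i hi => ModuleCat.subsingleton_ext_of_exists_isRegular I (ModuleCat.of R (R ⧸ I)) ?_
    (ModuleCat.of R M) hI rs hrs ⟨h, ?_⟩ i hi
  · change Module.support R (R ⧸ I) ⊆ _
    rw [Module.support_eq_zeroLocus, Ideal.annihilator_quotient]
  · exact ((Submodule.smul_mono_left hle).trans_lt hI).ne'

lemma ExtDepthGE.exists_isWeaklyRegular {R : Type} [CommRing R] [IsNoetherianRing R] {I : Ideal R}
    {M : Type} [AddCommGroup M] [Module R M] [Module.Finite R M] {d : ℕ}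
    (hI : (I • ⊤ : Submodule R M) < ⊤) (h : ExtDepthGE I d M) :
    ∃ rs : List R, rs.length = d ∧ (∀ r ∈ rs, r ∈ I) ∧
      RingTheory.Sequence.IsWeaklyRegular M rs := by
  obtain ⟨rs, h₁, h₂, h₃⟩ := ModuleCat.exists_isRegular_of_exists_subsingleton_ext I d
    (ModuleCat.of R M) hI (ModuleCat.of R (R ⧸ I))
    (by change Module.support R (R ⧸ I) = _
        rw [Module.support_eq_zeroLocus, Ideal.annihilator_quotient]) h
  exact ⟨rs, h₁, h₂, h₃.toIsWeaklyRegular⟩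

lemma MvPolynomial.extDepthGE_of_finiteDimensional {K : Type} [Field K] {n : ℕ}
    {I : Ideal (MvPolynomial (Fin n) K)} [FiniteDimensional K (MvPolynomial (Fin n) K ⧸ I)]
    (hI : I ≠ ⊤) : ExtDepthGE I n (MvPolynomial (Fin n) K) := by
  obtain ⟨rs, hlen, hrs, hreg⟩ := MvPolynomial.exists_isWeaklyRegular_aeval_X n
    (fun i => minpoly K (Ideal.Quotient.mkₐ K I (X i)))
    fun i => minpoly.monic (Algebra.IsIntegral.isIntegral _)
  refine (ExtDepthGE.of_isWeaklyRegular (by simpa [lt_top_iff_ne_top] using hI)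
    (fun r hr => ?_) hreg).mono hlen.ge
  obtain ⟨i, rfl⟩ := hrs r hr
  rw [← Ideal.Quotient.eq_zero_iff_mem, ← Ideal.Quotient.mkₐ_eq_mk K,
    ← Polynomial.aeval_algHom_apply, minpoly.aeval]

lemma MvPolynomial.extDepthGE_map_quotient {K : Type} [Field K] {n d : ℕ}
    {I Q : Ideal (MvPolynomial (Fin n) K)} [FiniteDimensional K (MvPolynomial (Fin n) K ⧸ I)]
    {rs : List (MvPolynomial (Fin n) K)} (hQ : Ideal.ofList rs = Q)
    (hrs : RingTheory.Sequence.IsWeaklyRegular (MvPolynomial (Fin n) K) rs)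
    (hd : d + rs.length ≤ n) (hI : I.map (Ideal.Quotient.mk Q) ≠ ⊤) :
    ExtDepthGE (I.map (Ideal.Quotient.mk Q)) d (MvPolynomial (Fin n) K ⧸ Q) := by
  have hI' : I ≠ ⊤ := fun h => hI (by rw [h, Ideal.map_top])
  have h₁ : ExtDepthGE I d (MvPolynomial (Fin n) K ⧸ Q) :=
    ExtDepthGE.of_linearEquiv
      (Submodule.quotEquivOfEq _ _ (by rw [smul_eq_mul, Ideal.mul_top, hQ]))
      (((extDepthGE_of_finiteDimensional hI').mono hd).quotient_of_isWeaklyRegular rs hrs)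
  have hlt : (I • ⊤ : Submodule (MvPolynomial (Fin n) K) (MvPolynomial (Fin n) K ⧸ Q)) < ⊤ := by
    rw [Ideal.smul_top_eq_map, lt_top_iff_ne_top]
    exact fun h => hI ((Submodule.restrictScalars_eq_top_iff _ _ _).mp h)
  obtain ⟨xs, rfl, hxI, hx⟩ := h₁.exists_isWeaklyRegular hlt
  rw [← RingTheory.Sequence.isWeaklyRegular_map_algebraMap_iff (MvPolynomial (Fin n) K ⧸ Q)] at hx
  rw [← List.length_map (algebraMap _ (MvPolynomial (Fin n) K ⧸ Q))]
  refine ExtDepthGE.of_isWeaklyRegular (by simpa [lt_top_iff_ne_top] using hI) (fun r hr => ?_) hx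
  obtain ⟨x, hx', rfl⟩ := List.mem_map.mp hr
  exact Ideal.mem_map_of_mem _ (hxI x hx')

lemma MvPolynomial.derivation_eq_sum_pderiv_smul {K σ N : Type*} [CommRing K] [Fintype σ]
    [AddCommGroup N] [Module K N] [Module (MvPolynomial σ K) N]
    [IsScalarTower K (MvPolynomial σ K) N] (D : Derivation K (MvPolynomial σ K) N)
    (f : MvPolynomial σ K) : D f = ∑ i, pderiv i f • D (X i) := by
  classical
  let E : σ → Derivation K (MvPolynomial σ K) N := fun i =>
    (LinearMap.toSpanSingleton _ N (D (X i))).compDer (pderiv i)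
  have hE : ∀ g, (∑ i, E i) g = ∑ i, pderiv i g • D (X i) := fun g => by
    rw [← Derivation.coeFnAddMonoidHom_apply, map_sum, Finset.sum_apply]
    rfl
  have h : D = ∑ i, E i := MvPolynomial.derivation_ext fun j => by
    simp [hE, pderiv_X, Pi.single_apply, ite_smul]
  rw [← hE, ← h]

/-- The derivation `br u` attached to a Poisson bracket on a quotient of a polynomial ring,
pulled back to the polynomial ring. -/
noncomputable def IsPoissonBracket.derivation {σ : Type*} {Q : Ideal (MvPolynomial σ ℂ)}
    {br : MvPolynomial σ ℂ ⧸ Q → MvPolynomial σ ℂ ⧸ Q → MvPolynomial σ ℂ ⧸ Q}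
    (hbr : IsPoissonBracket br) (u : MvPolynomial σ ℂ ⧸ Q) :
    Derivation ℂ (MvPolynomial σ ℂ) (MvPolynomial σ ℂ ⧸ Q) :=
  Derivation.mk' ((IsLinearMap.mk' (br u) (IsLinearMap.mk
    (fun x y => by simpa using hbr.2.1 1 u x y)
    (fun c x => by
      have h0 : br u 0 = 0 := by simpa using hbr.2.1 1 u 0 0
      simpa [h0] using hbr.2.1 c u x 0))) ∘ₗ (Ideal.Quotient.mkₐ ℂ Q).toLinearMap)
    fun a b => by
      have := hbr.2.2.2.1 u (Ideal.Quotient.mk Q a) (Ideal.Quotient.mk Q b)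
      simp only [LinearMap.comp_apply, AlgHom.toLinearMap_apply, Ideal.Quotient.mkₐ_eq_mk,
        IsLinearMap.mk'_apply, map_mul, this]
      rw [add_comm, mul_comm (br u _)]
      rfl

lemma IsPoissonBracket.apply_mk {σ : Type*} [Fintype σ] {Q : Ideal (MvPolynomial σ ℂ)}
    {br : MvPolynomial σ ℂ ⧸ Q → MvPolynomial σ ℂ ⧸ Q → MvPolynomial σ ℂ ⧸ Q}
    (hbr : IsPoissonBracket br) (u : MvPolynomial σ ℂ ⧸ Q) (f : MvPolynomial σ ℂ) :
    br u (Ideal.Quotient.mk Q f) =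
      ∑ l, br u (Ideal.Quotient.mk Q (X l)) * Ideal.Quotient.mk Q (pderiv l f) := by
  refine (MvPolynomial.derivation_eq_sum_pderiv_smul (hbr.derivation u) f).trans ?_
  refine Finset.sum_congr rfl fun l _ => ?_
  exact mul_comm (Ideal.Quotient.mk Q (pderiv l f)) _

theorem IsPoissonBracket.mem_span_minors {n m : ℕ} (hcodim : 2 ≤ n - m)
    {h : Fin m → MvPolynomial (Fin n) ℂ}
    (hreg : RingTheory.Sequence.IsWeaklyRegular (MvPolynomial (Fin n) ℂ) (List.ofFn h))
    {Q : Ideal (MvPolynomial (Fin n) ℂ)} (hQ : Q = Ideal.span (Set.range h))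
    [FiniteDimensional ℂ (MvPolynomial (Fin n) ℂ ⧸
      (Q ⊔ Ideal.span (Set.range fun c : Fin m → Fin n =>
        (Matrix.of fun i j => pderiv (c j) (h i)).det)))]
    {br : MvPolynomial (Fin n) ℂ ⧸ Q → MvPolynomial (Fin n) ℂ ⧸ Q → MvPolynomial (Fin n) ℂ ⧸ Q}
    (hbr : IsPoissonBracket br) (u v : MvPolynomial (Fin n) ℂ ⧸ Q) :
    br u v ∈ Ideal.span (Set.range fun c : Fin m → Fin n =>
      Ideal.Quotient.mk Q (Matrix.of fun i j => pderiv (c j) (h i)).det) := by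
  set mk := Ideal.Quotient.mk Q with hmk
  set I := Q ⊔ Ideal.span (Set.range fun c : Fin m → Fin n =>
    (Matrix.of fun i j => pderiv (c j) (h i)).det) with hI
  set J := Ideal.span (Set.range fun c : Fin m → Fin n =>
    mk (Matrix.of fun i j => pderiv (c j) (h i)).det) with hJ
  have hIJ : I.map mk = J := by
    rw [hI, Ideal.map_sup, Ideal.map_quotient_self, bot_sup_eq, Ideal.map_span, ← Set.range_comp]
    rfl
  by_cases hne : J = ⊤
  · rw [hne]; trivial
  have hminor : ∀ c : Fin m → Fin n, mk (Matrix.of fun i j => pderiv (c j) (h i)).det =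
      (Matrix.of fun i j => mk (pderiv (c j) (h i))).det := fun c => RingHom.map_det _ _
  have hdepth : ExtDepthGE J (n - m) (MvPolynomial (Fin n) ℂ ⧸ Q) := by
    rw [← hIJ] at hne ⊢
    exact MvPolynomial.extDepthGE_map_quotient
      (by rw [hQ, Ideal.ofList]; congr 1; ext; simp) hreg (by rw [List.length_ofFn]; omega) hne
  have key : ∀ k l, br (mk (X k)) (mk (X l)) ∈ J := by
    have h2 : IsUnit (2 : MvPolynomial (Fin n) ℂ ⧸ Q) := by
      have := (IsUnit.mk0 (2 : ℂ) two_ne_zero).map (algebraMap ℂ (MvPolynomial (Fin n) ℂ ⧸ Q))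
      rwa [map_ofNat] at this
    simp only [hJ, hminor] at hdepth ⊢
    refine mem_span_minors_of_sum_mul_eq_zero h2 (fun i k => mk (pderiv k (h i))) hdepth hcodim
      (by omega) (π := fun k l => br (mk (X k)) (mk (X l))) (fun k l => hbr.2.2.1 _ _)
      (fun i k => ?_)
    have h0 : mk (h i) = 0 :=
      Ideal.Quotient.eq_zero_iff_mem.mpr (hQ ▸ Ideal.subset_span ⟨i, rfl⟩)
    rw [← hbr.apply_mk, ← hmk, h0]
    simpa using hbr.2.1 1 (mk (X k)) 0 0
  obtain ⟨f, rfl⟩ := Ideal.Quotient.mk_surjective u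
  obtain ⟨g, rfl⟩ := Ideal.Quotient.mk_surjective v
  rw [hbr.apply_mk]
  refine J.sum_mem fun l _ => J.mul_mem_right _ ?_
  rw [hbr.2.2.1, hbr.apply_mk]
  exact J.neg_mem (J.sum_mem fun k _ => J.mul_mem_right _ (key l k))

theorem poisson_bracket_mem_jacobian_ideal_complete_intersection
    (n m : ℕ) (hmn : m < n) (hcodim : 2 ≤ n - m)
    (h : Fin m → MvPolynomial (Fin n) ℂ)
    -- `h₁, …, hₘ` is a regular sequence
    (hreg : RingTheory.Sequence.IsRegular (MvPolynomial (Fin n) ℂ) (List.ofFn h))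
    -- the complete intersection `h₁ = ⋯ = hₘ = 0` has isolated singularities:
    -- `A ⧸ ((h₁,…,hₘ) + J)` is finite dimensional over `ℂ`, where `J` is generated by
    -- the `m × m` minors of the Jacobian matrix `(∂ⱼhᵢ)`
    (hsing : FiniteDimensional ℂ
      ((MvPolynomial (Fin n) ℂ) ⧸
        (Ideal.span (Set.range h) ⊔
          Ideal.span (Set.range fun c : Fin m → Fin n =>
            (Matrix.of fun i j => pderiv (c j) (h i)).det))))
    (br : (MvPolynomial (Fin n) ℂ ⧸ Ideal.span (Set.range h)) →
      (MvPolynomial (Fin n) ℂ ⧸ Ideal.span (Set.range h)) →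
      (MvPolynomial (Fin n) ℂ ⧸ Ideal.span (Set.range h)))
    (hbr : IsPoissonBracket br)
    (P : Ideal (MvPolynomial (Fin n) ℂ ⧸ Ideal.span (Set.range h))) (hP : P.IsPrime) :
    ∀ u v : MvPolynomial (Fin n) ℂ ⧸ Ideal.span (Set.range h),
      algebraMap _ (Localization.AtPrime P) (br u v) ∈
        Ideal.span (Set.range fun c : Fin m → Fin n =>
          algebraMap _ (Localization.AtPrime P)
            (Ideal.Quotient.mk (Ideal.span (Set.range h))
              (Matrix.of fun i j => pderiv (c j) (h i)).det)) := by
  intro u v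
  have huv := Ideal.mem_map_of_mem (algebraMap _ (Localization.AtPrime P))
    (hbr.mem_span_minors hcodim hreg.toIsWeaklyRegular rfl u v)
  rwa [Ideal.map_span, ← Set.range_comp] at huv
end

section
/- Let h ∈ ℂ[x₁,x₂,x₃] and define B : ℂ[x₁,x₂,x₃] × ℂ[x₁,x₂,x₃] → ℂ[x₁,x₂,x₃] by B(f,g) = det M, where M is the 3×3 matrix with rows (∂₁f, ∂₂f, ∂₃f), (∂₁g, ∂₂g, ∂₃g), (∂₁h, ∂₂h, ∂₃h). Then B is ℂ-bilinear, antisymmetric, a derivation in each argument, satisfies the Jacobi identity B(B(f,g),k) + B(B(g,k),f) + B(B(k,f),g) = 0 for all f, g, k ∈ ℂ[x₁,x₂,x₃], and satisfies B(f,h) = 0 for all f. Consequently B descends to a well-defined Poisson bracket on the quotient ℂ[x₁,x₂,x₃]/(h) given by {[f],[g]} = [B(f,g)]. -/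
open MvPolynomial

/-- The Jacobian bracket `B(f, g) = det (∂ⱼf; ∂ⱼg; ∂ⱼh)` on `ℂ[x₁, x₂, x₃]`
associated to a polynomial `h`. -/
noncomputable def jacobianBracket (h : MvPolynomial (Fin 3) ℂ)
    (f g : MvPolynomial (Fin 3) ℂ) : MvPolynomial (Fin 3) ℂ :=
  (Matrix.of fun r c => pderiv c (![f, g, h] r)).det

namespace MvPolynomial

theorem pderiv_pderiv_comm {σ R : Type*} [CommSemiring R] (i j : σ) (f : MvPolynomial σ R) :
    pderiv i (pderiv j f) = pderiv j (pderiv i f) := by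
  classical
  induction f using MvPolynomial.induction_on with
  | C a => simp
  | add p q hp hq => simp only [map_add, hp, hq]
  | mul_X p k hp =>
    have hX (i j : σ) : pderiv i (pderiv j (X k : MvPolynomial σ R)) = 0 := by
      rw [pderiv_X, Pi.single_apply]
      split_ifs <;> simp
    simp only [pderiv_mul, map_add, hp, hX]
    ring

end MvPolynomial

theorem jacobianBracket_eq (h f g : MvPolynomial (Fin 3) ℂ) :
    jacobianBracket h f g =
      pderiv 0 f * (pderiv 1 g * pderiv 2 h - pderiv 2 g * pderiv 1 h) -
        pderiv 1 f * (pderiv 0 g * pderiv 2 h - pderiv 2 g * pderiv 0 h) +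
        pderiv 2 f * (pderiv 0 g * pderiv 1 h - pderiv 1 g * pderiv 0 h) := by
  simp only [jacobianBracket, Matrix.det_fin_three, Matrix.of_apply, Matrix.cons_val]
  ring

theorem jacobianBracket_smul_add_left (h : MvPolynomial (Fin 3) ℂ) (c : ℂ)
    (f g k : MvPolynomial (Fin 3) ℂ) :
    jacobianBracket h (c • f + g) k = c • jacobianBracket h f k + jacobianBracket h g k := by
  simp only [jacobianBracket_eq, map_add, smul_eq_C_mul, pderiv_C_mul]
  ring

theorem jacobianBracket_antisymm (h f g : MvPolynomial (Fin 3) ℂ) :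
    jacobianBracket h f g = - jacobianBracket h g f := by
  simp only [jacobianBracket_eq]
  ring

theorem jacobianBracket_smul_add_right (h : MvPolynomial (Fin 3) ℂ) (c : ℂ)
    (f g k : MvPolynomial (Fin 3) ℂ) :
    jacobianBracket h f (c • g + k) = c • jacobianBracket h f g + jacobianBracket h f k := by
  simp only [jacobianBracket_antisymm h f, jacobianBracket_smul_add_left, smul_neg, neg_add]

theorem jacobianBracket_mul_left (h f g k : MvPolynomial (Fin 3) ℂ) :
    jacobianBracket h (f * g) k = jacobianBracket h f k * g + f * jacobianBracket h g k := by
  simp only [jacobianBracket_eq, Derivation.leibniz, smul_eq_mul]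
  ring

theorem jacobianBracket_mul_right (h f g k : MvPolynomial (Fin 3) ℂ) :
    jacobianBracket h f (g * k) = jacobianBracket h f g * k + g * jacobianBracket h f k := by
  simp only [jacobianBracket_antisymm h f, jacobianBracket_mul_left]
  ring

theorem jacobianBracket_jacobi (h f g k : MvPolynomial (Fin 3) ℂ) :
    jacobianBracket h (jacobianBracket h f g) k + jacobianBracket h (jacobianBracket h g k) f +
      jacobianBracket h (jacobianBracket h k f) g = 0 := by
  simp only [jacobianBracket_eq, map_add, map_sub, Derivation.leibniz, smul_eq_mul,
    pderiv_pderiv_comm (1 : Fin 3) 0, pderiv_pderiv_comm (2 : Fin 3) 0,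
    pderiv_pderiv_comm (2 : Fin 3) 1]
  ring

theorem jacobianBracket_self_right (h f : MvPolynomial (Fin 3) ℂ) :
    jacobianBracket h f h = 0 := by
  rw [jacobianBracket_eq]
  ring

theorem jacobianBracket_sub_mem_span {h f f' g g' : MvPolynomial (Fin 3) ℂ}
    (hf : f - f' ∈ Ideal.span {h}) (hg : g - g' ∈ Ideal.span {h}) :
    jacobianBracket h f g - jacobianBracket h f' g' ∈ Ideal.span {h} := by
  rw [Ideal.mem_span_singleton] at *
  obtain ⟨a, ha⟩ := hf
  obtain ⟨b, hb⟩ := hg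
  obtain rfl : f = f' + h * a := by rw [← ha]; ring
  obtain rfl : g = g' + h * b := by rw [← hb]; ring
  refine ⟨jacobianBracket h a (g' + h * b) + jacobianBracket h f' b, ?_⟩
  simp only [jacobianBracket_eq, map_add, Derivation.leibniz, smul_eq_mul]
  ring

/-- The bracket induced by `jacobianBracket h` on `ℂ[x₁, x₂, x₃] / (h)`. -/
noncomputable def quotientJacobianBracket (h : MvPolynomial (Fin 3) ℂ)
    (f g : MvPolynomial (Fin 3) ℂ ⧸ Ideal.span {h}) : MvPolynomial (Fin 3) ℂ ⧸ Ideal.span {h} :=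
  Quotient.liftOn₂' f g (fun f g => Ideal.Quotient.mk (Ideal.span {h}) (jacobianBracket h f g))
    fun _ _ _ _ hf hg => Ideal.Quotient.eq.2 <| jacobianBracket_sub_mem_span
      ((Submodule.quotientRel_def _).1 hf) ((Submodule.quotientRel_def _).1 hg)

theorem quotientJacobianBracket_mk (h f g : MvPolynomial (Fin 3) ℂ) :
    quotientJacobianBracket h (Ideal.Quotient.mk (Ideal.span {h}) f)
        (Ideal.Quotient.mk (Ideal.span {h}) g) =
      Ideal.Quotient.mk (Ideal.span {h}) (jacobianBracket h f g) :=
  rfl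

theorem isPoissonBracket_jacobianBracket (h : MvPolynomial (Fin 3) ℂ) :
    IsPoissonBracket (jacobianBracket h) := by
  refine ⟨jacobianBracket_smul_add_left h, jacobianBracket_smul_add_right h,
    jacobianBracket_antisymm h, jacobianBracket_mul_right h, jacobianBracket_mul_left h,
    fun f g k => ?_⟩
  rw [jacobianBracket_antisymm h f (jacobianBracket h g k),
    jacobianBracket_antisymm h g (jacobianBracket h k f),
    jacobianBracket_antisymm h k (jacobianBracket h f g)]
  linear_combination -jacobianBracket_jacobi h f g k

/-- Poisson brackets descend along surjective algebra homomorphisms that intertwine brackets. -/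
theorem IsPoissonBracket.of_surjective {R S : Type*} [CommRing R] [Algebra ℂ R] [CommRing S]
    [Algebra ℂ S] {br : R → R → R} {br' : S → S → S} (hbr : IsPoissonBracket br) (φ : R →ₐ[ℂ] S)
    (hφ : Function.Surjective φ) (hcomm : ∀ f g, br' (φ f) (φ g) = φ (br f g)) :
    IsPoissonBracket br' := by
  obtain ⟨add_left, add_right, antisymm, mul_right, mul_left, jacobi⟩ := hbr
  refine ⟨fun c => hφ.forall₃.2 fun f g k => ?_, fun c => hφ.forall₃.2 fun f g k => ?_,
    hφ.forall₂.2 fun f g => ?_, hφ.forall₃.2 fun f g k => ?_, hφ.forall₃.2 fun f g k => ?_,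
    hφ.forall₃.2 fun f g k => ?_⟩
  · simp only [← map_smul, ← map_add, hcomm, add_left]
  · simp only [← map_smul, ← map_add, hcomm, add_right]
  · rw [hcomm, hcomm, antisymm, map_neg]
  · simp only [← map_mul, ← map_add, hcomm, mul_right]
  · simp only [← map_mul, ← map_add, hcomm, mul_left]
  · simp only [← map_add, hcomm, jacobi, map_zero]

theorem jacobianBracket_isPoisson (h : MvPolynomial (Fin 3) ℂ) :
    -- `B` is `ℂ`-bilinear
    (∀ (c : ℂ) (f g k : MvPolynomial (Fin 3) ℂ),
      jacobianBracket h (c • f + g) k = c • jacobianBracket h f k + jacobianBracket h g k) ∧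
    (∀ (c : ℂ) (f g k : MvPolynomial (Fin 3) ℂ),
      jacobianBracket h f (c • g + k) = c • jacobianBracket h f g + jacobianBracket h f k) ∧
    -- `B` is antisymmetric
    (∀ f g : MvPolynomial (Fin 3) ℂ, jacobianBracket h f g = - jacobianBracket h g f) ∧
    -- `B` is a derivation in each argument
    (∀ f g k : MvPolynomial (Fin 3) ℂ,
      jacobianBracket h f (g * k) =
        jacobianBracket h f g * k + g * jacobianBracket h f k) ∧
    (∀ f g k : MvPolynomial (Fin 3) ℂ,
      jacobianBracket h (f * g) k =
        jacobianBracket h f k * g + f * jacobianBracket h g k) ∧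
    -- `B` satisfies the Jacobi identity
    (∀ f g k : MvPolynomial (Fin 3) ℂ,
      jacobianBracket h (jacobianBracket h f g) k +
        jacobianBracket h (jacobianBracket h g k) f +
        jacobianBracket h (jacobianBracket h k f) g = 0) ∧
    -- `B(f, h) = 0`
    (∀ f : MvPolynomial (Fin 3) ℂ, jacobianBracket h f h = 0) ∧
    -- consequently `B` descends to a Poisson bracket on `ℂ[x₁,x₂,x₃]/(h)`
    (∃ br : (MvPolynomial (Fin 3) ℂ ⧸ Ideal.span {h}) →
        (MvPolynomial (Fin 3) ℂ ⧸ Ideal.span {h}) →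
        (MvPolynomial (Fin 3) ℂ ⧸ Ideal.span {h}),
      IsPoissonBracket br ∧
      ∀ f g : MvPolynomial (Fin 3) ℂ,
        br (Ideal.Quotient.mk (Ideal.span {h}) f) (Ideal.Quotient.mk (Ideal.span {h}) g) =
          Ideal.Quotient.mk (Ideal.span {h}) (jacobianBracket h f g)) := by
  exact ⟨jacobianBracket_smul_add_left h, jacobianBracket_smul_add_right h,
    jacobianBracket_antisymm h, jacobianBracket_mul_right h, jacobianBracket_mul_left h,
    jacobianBracket_jacobi h, jacobianBracket_self_right h, quotientJacobianBracket h,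
    (isPoissonBracket_jacobianBracket h).of_surjective (Ideal.Quotient.mkₐ ℂ (Ideal.span {h}))
      (Ideal.Quotient.mkₐ_surjective ℂ _) (quotientJacobianBracket_mk h),
    quotientJacobianBracket_mk h⟩
end

section
/- Let w : Fin 3 → ℕ be weights with w i ≥ 1 for all i, and let h ∈ ℂ[x₁,x₂,x₃] be weighted homogeneous of degree d with respect to w, such that ℂ[x₁,x₂,x₃]/(h, ∂₁h, ∂₂h, ∂₃h) is a finite-dimensional ℂ-vector space. Let {-,-} be a Poisson bracket on O = ℂ[x₁,x₂,x₃]/(h) such that whenever F is weighted homogeneous of degree a and G is weighted homogeneous of degree b, the bracket {[F],[G]} is the class of a weighted homogeneous polynomial of degree a + b + d − (w 0 + w 1 + w 2). Then there exists a constant c ∈ ℂ such that for all F, G ∈ ℂ[x₁,x₂,x₃], {[F],[G]} = c · [Jac(F,G,h)], where Jac(F,G,h) is the determinant of the 3×3 matrix with rows (∂₁F, ∂₂F, ∂₃F), (∂₁G, ∂₂G, ∂₃G), (∂₁h, ∂₂h, ∂₃h). -/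
open MvPolynomial

open scoped Matrix

section Koszul

variable {R : Type*} [CommRing R] {f : Fin 3 → R}

lemma exists_dotProduct_eq_of_mem_span_range {a : R} (ha : a ∈ Ideal.span (Set.range f)) :
    ∃ u : Fin 3 → R, u 0 * f 0 + u 1 * f 1 + u 2 * f 2 = a := by
  obtain ⟨u, hu⟩ := Ideal.mem_span_range_iff_exists_fun.mp ha
  exact ⟨u, by simpa [Fin.sum_univ_three] using hu⟩

/-- Exactness of the Koszul complex of `f` at the spot governed by a regular sequence of length
two in the ideal generated by the entries of `f`. -/
theorem exists_eq_smul_of_crossProduct_eq_zero [IsDomain R] {a b : R} (ha₀ : a ≠ 0)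
    (ha : a ∈ Ideal.span (Set.range f)) (hb : b ∈ Ideal.span (Set.range f))
    (hab : ∀ t, b * t ∈ Ideal.span {a} → t ∈ Ideal.span {a})
    {p : Fin 3 → R} (hp : p ⨯₃ f = 0) : ∃ t : R, p = t • f := by
  obtain ⟨u, rfl⟩ := exists_dotProduct_eq_of_mem_span_range ha
  obtain ⟨v, rfl⟩ := exists_dotProduct_eq_of_mem_span_range hb
  simp only [Ideal.mem_span_singleton] at hab
  rw [cross_apply] at hp
  have h0 : p 1 * f 2 - p 2 * f 1 = 0 := congrFun hp 0
  have h1 : p 2 * f 0 - p 0 * f 2 = 0 := congrFun hp 1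
  have h2 : p 0 * f 1 - p 1 * f 0 = 0 := congrFun hp 2
  obtain ⟨t, ht⟩ := hab (u 0 * p 0 + u 1 * p 1 + u 2 * p 2)
    ⟨v 0 * p 0 + v 1 * p 1 + v 2 * p 2, by
      linear_combination (u 1 * v 2 - u 2 * v 1) * h0 + (u 2 * v 0 - u 0 * v 2) * h1 +
        (u 0 * v 1 - u 1 * v 0) * h2⟩
  refine ⟨t, funext fun i => mul_left_cancel₀ ha₀ ?_⟩
  fin_cases i <;> simp only [Fin.mk_one, Fin.reduceFinMk, Fin.zero_eta, Fin.isValue,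
    Pi.smul_apply, smul_eq_mul]
  · linear_combination f 0 * ht + u 1 * h2 - u 2 * h1
  · linear_combination f 1 * ht + u 2 * h0 - u 0 * h2
  · linear_combination f 2 * ht + u 0 * h1 - u 1 * h0

/-- Exactness of the Koszul complex of `f` at the spot governed by a regular sequence of length
three in the ideal generated by the entries of `f`. -/
theorem exists_eq_crossProduct_of_dotProduct_eq_zero [IsDomain R] {a b c : R} (ha₀ : a ≠ 0)
    (ha : a ∈ Ideal.span (Set.range f)) (hb : b ∈ Ideal.span (Set.range f))
    (hc : c ∈ Ideal.span (Set.range f))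
    (hab : ∀ t, b * t ∈ Ideal.span {a} → t ∈ Ideal.span {a})
    (habc : ∀ t, c * t ∈ Ideal.span {a, b} → t ∈ Ideal.span {a, b})
    {q : Fin 3 → R} (hq : q 0 * f 0 + q 1 * f 1 + q 2 * f 2 = 0) :
    ∃ r : Fin 3 → R, q = f ⨯₃ r := by
  obtain ⟨u, rfl⟩ := exists_dotProduct_eq_of_mem_span_range ha
  obtain ⟨v, rfl⟩ := exists_dotProduct_eq_of_mem_span_range hb
  obtain ⟨z, rfl⟩ := exists_dotProduct_eq_of_mem_span_range hc
  set a := u 0 * f 0 + u 1 * f 1 + u 2 * f 2 with haf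
  set b := v 0 * f 0 + v 1 * f 1 + v 2 * f 2 with hbf
  simp only [Ideal.mem_span_singleton, Ideal.mem_span_pair] at hab habc
  set s₀ := q 1 * u 2 - q 2 * u 1 with hs₀
  set s₁ := q 2 * u 0 - q 0 * u 2 with hs₁
  set s₂ := q 0 * u 1 - q 1 * u 0 with hs₂
  have e0 : f 1 * s₂ - f 2 * s₁ = a * q 0 := by
    linear_combination q 0 * haf - u 0 * hq
  have e1 : f 2 * s₀ - f 0 * s₂ = a * q 1 := by
    linear_combination q 1 * haf - u 1 * hq
  have e2 : f 0 * s₁ - f 1 * s₀ = a * q 2 := by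
    linear_combination q 2 * haf - u 2 * hq
  obtain ⟨m, n, hmn⟩ := habc (v 0 * s₀ + v 1 * s₁ + v 2 * s₂)
    ⟨q 0 * (z 1 * v 2 - z 2 * v 1) + q 1 * (z 2 * v 0 - z 0 * v 2) + q 2 * (z 0 * v 1 - z 1 * v 0),
      z 0 * s₀ + z 1 * s₁ + z 2 * s₂, by
      linear_combination (z 0 * s₀ + z 1 * s₁ + z 2 * s₂) * hbf -
        (z 1 * v 2 - z 2 * v 1) * e0 - (z 2 * v 0 - z 0 * v 2) * e1 -
        (z 0 * v 1 - z 1 * v 0) * e2⟩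
  obtain ⟨r₀, hr₀⟩ := hab (s₀ - n * f 0) ⟨m * f 0 + (q 1 * v 2 - q 2 * v 1), by
    linear_combination s₀ * hbf - f 0 * hmn + v 2 * e1 - v 1 * e2⟩
  obtain ⟨r₁, hr₁⟩ := hab (s₁ - n * f 1) ⟨m * f 1 + (q 2 * v 0 - q 0 * v 2), by
    linear_combination s₁ * hbf - f 1 * hmn + v 0 * e2 - v 2 * e0⟩
  obtain ⟨r₂, hr₂⟩ := hab (s₂ - n * f 2) ⟨m * f 2 + (q 0 * v 1 - q 1 * v 0), by
    linear_combination s₂ * hbf - f 2 * hmn + v 1 * e0 - v 0 * e1⟩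
  refine ⟨![r₀, r₁, r₂], funext fun i => mul_left_cancel₀ ha₀ ?_⟩
  fin_cases i <;> simp only [cross_apply, Fin.mk_one, Fin.reduceFinMk, Fin.zero_eta, Fin.isValue,
    Matrix.cons_val]
  · linear_combination -e0 + f 1 * hr₂ - f 2 * hr₁
  · linear_combination -e1 + f 2 * hr₀ - f 0 * hr₂
  · linear_combination -e2 + f 0 * hr₁ - f 1 * hr₀

end Koszul

namespace MvPolynomial

section

variable {σ R : Type*} [CommRing R]

lemma mem_span_X_pow_image {s : Set σ} {N : ℕ} {t : MvPolynomial σ R} :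
    t ∈ Ideal.span ((fun i => (X i : MvPolynomial σ R) ^ N) '' s) ↔
      ∀ m ∈ t.support, ∃ i ∈ s, N ≤ m i := by
  have := mem_ideal_span_monomial_image (x := t) (s := (fun i => Finsupp.single i N) '' s)
  rw [Set.image_image] at this
  simpa [X_pow_eq_monomial] using this

/-- Powers of the variables form a regular sequence. -/
lemma mem_span_X_pow_image_of_mul_mem {s : Set σ} {j : σ} (hj : j ∉ s) {N : ℕ}
    {t : MvPolynomial σ R}
    (ht : X j ^ N * t ∈ Ideal.span ((fun i => (X i : MvPolynomial σ R) ^ N) '' s)) :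
    t ∈ Ideal.span ((fun i => (X i : MvPolynomial σ R) ^ N) '' s) := by
  rw [mem_span_X_pow_image] at ht ⊢
  intro m hm
  obtain ⟨i, his, hi⟩ := ht (Finsupp.single j N + m) (by
    rwa [mem_support_iff, X_pow_eq_monomial, coeff_monomial_mul, one_mul, ← mem_support_iff])
  refine ⟨i, his, ?_⟩
  have hij : j ≠ i := fun e => hj (e ▸ his)
  simpa [Finsupp.single_apply, hij] using hi

lemma weightedHomogeneousComponent_mul_of_left {M : Type*} [AddCommGroup M] {w : σ → M} {m : M}
    {F : MvPolynomial σ R} (hF : IsWeightedHomogeneous w F m) (G : MvPolynomial σ R) (n : M) :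
    weightedHomogeneousComponent w n (F * G) = F * weightedHomogeneousComponent w (n - m) G := by
  classical
  let := weightedGradedAlgebra R w
  have := DirectSum.coe_decompose_mul_add_of_left_mem (weightedHomogeneousSubmodule R w)
    (i := m) (j := n - m) (b := G) hF
  rw [add_sub_cancel] at this
  simp only [← weightedDecomposition.decompose'_apply]
  exact this

lemma exists_X_pow_mem_of_isHomogeneous {K : Type*} [Field K] {w : σ → ℕ} {j : σ} (hj : w j ≠ 0)
    {I : Ideal (MvPolynomial σ K)}
    (hI : letI := weightedGradedAlgebra K w; I.IsHomogeneous (weightedHomogeneousSubmodule K w))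
    (hfin : FiniteDimensional K (MvPolynomial σ K ⧸ I)) :
    ∃ n, (X j : MvPolynomial σ K) ^ n ∈ I := by
  obtain ⟨p, hp₀, hp⟩ := Algebra.IsAlgebraic.isAlgebraic (R := K) (Ideal.Quotient.mkₐ K I (X j))
  rw [Polynomial.aeval_algHom_apply, Ideal.Quotient.mkₐ_eq_mk, Ideal.Quotient.eq_zero_iff_mem] at hp
  obtain ⟨n, hn⟩ := Polynomial.support_nonempty.mpr hp₀
  refine ⟨n, ?_⟩
  have h1 := weightedHomogeneousComponent_mem_of_mem K w hI hp (n * w j)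
  have h2 : weightedHomogeneousComponent w (n * w j) (Polynomial.aeval (X j) p) =
      C (p.coeff n) * (X j : MvPolynomial σ K) ^ n := by
    rw [Polynomial.aeval_eq_sum_range, map_sum, Finset.sum_eq_single n]
    · rw [smul_eq_C_mul, weightedHomogeneousComponent_eq_self]
      exact ((isWeightedHomogeneous_X K w j).pow n).C_mul _
    · intro k _ hk
      rw [smul_eq_C_mul]
      refine (((isWeightedHomogeneous_X K w j).pow k).C_mul _).weightedHomogeneousComponent_ne _ ?_
      simpa [hj] using hk.symm
    · intro hn'
      exact absurd (Finset.mem_range_succ_iff.mpr (Polynomial.le_natDegree_of_mem_supp n hn)) hn'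
  rw [h2] at h1
  have := I.mul_mem_left (C (p.coeff n)⁻¹) h1
  rwa [← mul_assoc, ← C_mul, inv_mul_cancel₀ (Polynomial.mem_support_iff.mp hn), C_1,
    one_mul] at this

lemma weightedHomogeneousComponent_eq_zero_of_neg {w : σ → ℤ} (hw : ∀ i, 0 ≤ w i) {n : ℤ}
    (hn : n < 0) (F : MvPolynomial σ R) : weightedHomogeneousComponent w n F = 0 := by
  classical
  refine weightedHomogeneousComponent_eq_zero' _ _ fun m _ hm => ?_
  rw [Finsupp.weight_apply] at hm
  exact hn.not_ge (hm ▸ Finset.sum_nonneg fun i _ => nsmul_nonneg (hw i) _)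

lemma weightedHomogeneousComponent_zero_of_pos {w : σ → ℤ} (hw : ∀ i, 0 < w i)
    (F : MvPolynomial σ R) : weightedHomogeneousComponent w 0 F = C (coeff 0 F) := by
  classical
  ext m
  rw [coeff_weightedHomogeneousComponent, coeff_C]
  have : Finsupp.weight w m = 0 ↔ 0 = m := by
    refine ⟨fun h => ?_, fun h => by simp [← h]⟩
    rw [Finsupp.weight_apply, Finsupp.sum,
      Finset.sum_eq_zero_iff_of_nonneg fun i _ => nsmul_nonneg (hw i).le _] at h
    ext i
    by_contra hi
    have := h i (Finsupp.mem_support_iff.mpr (Ne.symm hi))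
    simp only [smul_eq_zero, (hw i).ne', or_false] at this
    exact hi this.symm
  simp only [this]
  split_ifs with h <;> simp [h]

lemma IsWeightedHomogeneous.natCast {w : σ → ℕ} {F : MvPolynomial σ R} {n : ℕ}
    (hF : IsWeightedHomogeneous w F n) :
    IsWeightedHomogeneous (fun i => (w i : ℤ)) F (n : ℤ) := by
  intro m hm
  rw [← hF hm, Finsupp.weight_apply, Finsupp.weight_apply, Finsupp.sum, Finsupp.sum]
  push_cast
  simp

end

end MvPolynomial

/-- The chain rule for a derivation on a polynomial ring. -/
lemma MvPolynomial.derivation_apply_eq_sum {σ R A : Type*} [Fintype σ] [CommSemiring R]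
    [AddCommMonoid A] [Module R A] [Module (MvPolynomial σ R) A]
    (D : Derivation R (MvPolynomial σ R) A) (F : MvPolynomial σ R) :
    D F = ∑ i, pderiv i F • D (X i) := by
  classical
  induction F using MvPolynomial.induction_on with
  | C a => simp
  | add p q hp hq => simp [hp, hq, add_smul, Finset.sum_add_distrib]
  | mul_X p j hp =>
    simp [hp, pderiv_X, Pi.single_apply, add_smul, Finset.sum_add_distrib, Finset.smul_sum,
      mul_smul, ite_smul]

section Poisson

variable {I : Ideal (MvPolynomial (Fin 3) ℂ)}
  {br : (MvPolynomial (Fin 3) ℂ ⧸ I) → (MvPolynomial (Fin 3) ℂ ⧸ I) →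
    (MvPolynomial (Fin 3) ℂ ⧸ I)}

lemma IsPoissonBracket.apply_mk_eq_sum (hbr : IsPoissonBracket br) (f : MvPolynomial (Fin 3) ℂ ⧸ I)
    (G : MvPolynomial (Fin 3) ℂ) :
    br f (Ideal.Quotient.mk I G) =
      ∑ i, Ideal.Quotient.mk I (pderiv i G) * br f (Ideal.Quotient.mk I (X i)) := by
  obtain ⟨-, hlin, -, hder, -, -⟩ := hbr
  have h_zero : br f 0 = 0 := by simpa using hlin 1 f 0 0
  let D : Derivation ℂ (MvPolynomial (Fin 3) ℂ) (MvPolynomial (Fin 3) ℂ ⧸ I) :=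
    Derivation.mk'
      { toFun := fun G => br f (Ideal.Quotient.mk I G)
        map_add' := fun G H => by
          simpa using hlin 1 f (Ideal.Quotient.mk I G) (Ideal.Quotient.mk I H)
        map_smul' := fun c G => by
          have := hlin c f (Ideal.Quotient.mk I G) 0
          rwa [add_zero, h_zero, add_zero] at this }
      fun G H => by
        change br f (Ideal.Quotient.mk I (G * H)) =
          Ideal.Quotient.mk I G * br f (Ideal.Quotient.mk I H) +
            Ideal.Quotient.mk I H * br f (Ideal.Quotient.mk I G)
        rw [map_mul, hder]
        ring
  exact derivation_apply_eq_sum D G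

lemma IsPoissonBracket.self_eq_zero (hbr : IsPoissonBracket br) (f : MvPolynomial (Fin 3) ℂ ⧸ I) :
    br f f = 0 := by
  have h2 : (2 : ℂ) • br f f = 0 := by
    rw [two_smul]
    nth_rewrite 1 [hbr.2.2.1 f f]
    exact neg_add_cancel _
  exact (smul_eq_zero_iff_right (two_ne_zero)).mp h2

/-- A Poisson bracket on a quotient of `ℂ[x₀, x₁, x₂]` is determined by the brackets of the
variables. -/
lemma IsPoissonBracket.mk_mk_eq (hbr : IsPoissonBracket br) {P : Fin 3 → MvPolynomial (Fin 3) ℂ}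
    (hP : ∀ i, br (Ideal.Quotient.mk I (X (i + 1))) (Ideal.Quotient.mk I (X (i + 2))) =
      Ideal.Quotient.mk I (P i)) (F G : MvPolynomial (Fin 3) ℂ) :
    br (Ideal.Quotient.mk I F) (Ideal.Quotient.mk I G) =
      Ideal.Quotient.mk I (Matrix.of ![fun s => pderiv s F, fun s => pderiv s G, P]).det := by
  have h0 := hP 0
  have h1 := hP 1
  have h2 := hP 2
  simp only [Fin.isValue, zero_add, Fin.reduceAdd] at h0 h1 h2
  have anti := hbr.2.2.1
  have key : ∀ i, br (Ideal.Quotient.mk I F) (Ideal.Quotient.mk I (X i)) =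
      -∑ j, Ideal.Quotient.mk I (pderiv j F) *
        br (Ideal.Quotient.mk I (X i)) (Ideal.Quotient.mk I (X j)) := fun i => by
    rw [anti, hbr.apply_mk_eq_sum]
  rw [hbr.apply_mk_eq_sum]
  simp only [key, Fin.sum_univ_three, hbr.self_eq_zero, h0, h1, h2,
    anti (Ideal.Quotient.mk I (X 1)) (Ideal.Quotient.mk I (X 0)),
    anti (Ideal.Quotient.mk I (X 2)) (Ideal.Quotient.mk I (X 1)),
    anti (Ideal.Quotient.mk I (X 0)) (Ideal.Quotient.mk I (X 2))]
  rw [Matrix.det_fin_three]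
  simp only [Matrix.of_apply, Matrix.cons_val, map_sub, map_add, map_mul]
  ring

end Poisson

section WeightedHomogeneous

variable {w : Fin 3 → ℕ} {h : MvPolynomial (Fin 3) ℂ} {d : ℕ}

lemma MvPolynomial.IsWeightedHomogeneous.pderiv_int (hh : IsWeightedHomogeneous w h d) (i : Fin 3) :
    IsWeightedHomogeneous (fun i => (w i : ℤ)) (pderiv i h) (d - w i : ℤ) :=
  hh.natCast.pderiv (by simp)

lemma MvPolynomial.IsWeightedHomogeneous.isHomogeneous_span_insert_pderiv
    (hh : IsWeightedHomogeneous w h d) :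
    let := weightedGradedAlgebra ℂ w
    (Ideal.span (insert h (Set.range fun i => pderiv i h))).IsHomogeneous
      (weightedHomogeneousSubmodule ℂ w) := by
  intro
  apply Ideal.homogeneous_span
  rintro x (rfl | ⟨i, rfl⟩)
  · exact ⟨d, hh⟩
  · by_cases hid : w i ≤ d
    · exact ⟨d - w i, hh.pderiv (by omega)⟩
    · suffices pderiv i h = 0 by
        refine ⟨0, ?_⟩
        simp only [this]
        exact zero_mem _
      rw [← (hh.pderiv_int i).weightedHomogeneousComponent_same]
      exact weightedHomogeneousComponent_eq_zero_of_neg (fun i => by positivity) (by omega) _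

lemma MvPolynomial.IsWeightedHomogeneous.mem_span_range_pderiv (hd : d ≠ 0)
    (hh : IsWeightedHomogeneous w h d) : h ∈ Ideal.span (Set.range fun i => pderiv i h) := by
  have euler := hh.sum_weight_X_mul_pderiv
  have hmem : (d : ℕ) • h ∈ Ideal.span (Set.range fun i => pderiv i h) := by
    rw [← euler]
    refine Ideal.sum_mem _ fun i _ => nsmul_mem (Ideal.mul_mem_left _ _ ?_) _
    exact Ideal.subset_span ⟨i, rfl⟩
  have := Ideal.mul_mem_left _ (C (d : ℂ)⁻¹) hmem
  rwa [nsmul_eq_mul, ← map_natCast (C : ℂ →+* MvPolynomial (Fin 3) ℂ), ← mul_assoc, ← map_mul,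
    inv_mul_cancel₀ (Nat.cast_ne_zero.mpr hd), map_one, one_mul] at this

lemma exists_X_pow_mem_span_insert_pderiv
    (hw : ∀ i, 1 ≤ w i) (hh : IsWeightedHomogeneous w h d)
    (hsing : FiniteDimensional ℂ
      ((MvPolynomial (Fin 3) ℂ) ⧸ Ideal.span (insert h (Set.range fun i => pderiv i h)))) :
    ∃ N, ∀ i, (X i : MvPolynomial (Fin 3) ℂ) ^ N ∈
      Ideal.span (insert h (Set.range fun i => pderiv i h)) := by
  have (i : Fin 3) := exists_X_pow_mem_of_isHomogeneous (j := i) (Nat.one_le_iff_ne_zero.mp (hw i))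
    hh.isHomogeneous_span_insert_pderiv hsing
  choose n hn using this
  exact ⟨∑ i, n i, fun i => Ideal.pow_mem_of_pow_mem _ (hn i)
    (Finset.single_le_sum (fun _ _ => Nat.zero_le _) (Finset.mem_univ i))⟩

lemma ne_zero_of_finiteDimensional_quotient
    (hw : ∀ i, 1 ≤ w i) (hh : IsWeightedHomogeneous w h d)
    (hsing : FiniteDimensional ℂ
      ((MvPolynomial (Fin 3) ℂ) ⧸ Ideal.span (insert h (Set.range fun i => pderiv i h)))) : h ≠ 0 := by
  rintro rfl
  obtain ⟨N, hN⟩ := exists_X_pow_mem_span_insert_pderiv hw hh hsing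
  have := hN 0
  have hle : Ideal.span (insert (0 : MvPolynomial (Fin 3) ℂ)
      (Set.range fun i : Fin 3 => pderiv i (0 : MvPolynomial (Fin 3) ℂ))) ≤ ⊥ := by
    rw [Ideal.span_le]
    rintro x (rfl | ⟨i, rfl⟩) <;> simp
  exact pow_ne_zero N (X_ne_zero 0) (Ideal.mem_bot.mp (hle this))

/-- If `P` has degree `d - w i` in its `i`-th entry and its cross product with the gradient of `h`
vanishes modulo `h`, then `P` is a constant multiple of the gradient of `h`. -/
lemma exists_eq_C_mul_pderiv_of_crossProduct_mem
    (hw : ∀ i, 1 ≤ w i) (hh : IsWeightedHomogeneous w h d)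
    (hsing : FiniteDimensional ℂ
      ((MvPolynomial (Fin 3) ℂ) ⧸ Ideal.span (insert h (Set.range fun i => pderiv i h))))
    (hd : d ≠ 0) {P : Fin 3 → MvPolynomial (Fin 3) ℂ}
    (hPdeg : ∀ i, IsWeightedHomogeneous (fun i => (w i : ℤ)) (P i) (d - w i : ℤ))
    (hP : ∀ i, h ∣ (P ⨯₃ fun i => pderiv i h) i) :
    ∃ c : ℂ, ∀ i, P i = C c * pderiv i h := by
  obtain ⟨N, hN⟩ := exists_X_pow_mem_span_insert_pderiv hw hh hsing
  have hspan : Ideal.span (insert h (Set.range fun i => pderiv i h)) =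
      Ideal.span (Set.range fun i => pderiv i h) :=
    Submodule.span_insert_eq_span (hh.mem_span_range_pderiv hd)
  rw [hspan] at hN
  have hh₀ := ne_zero_of_finiteDimensional_quotient hw hh hsing
  have hwn (i : Fin 3) : (0 : ℤ) ≤ w i := by positivity
  have hwp (i : Fin 3) : (0 : ℤ) < w i := by exact_mod_cast hw i
  have reg1 (t : MvPolynomial (Fin 3) ℂ) (ht : X 1 ^ N * t ∈ Ideal.span {X 0 ^ N}) :
      t ∈ Ideal.span {X 0 ^ N} := by
    have := mem_span_X_pow_image_of_mul_mem (s := {0}) (j := (1 : Fin 3)) (N := N) (t := t)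
    simp only [Set.image_singleton] at this
    exact this (by simp) ht
  have reg2 (t : MvPolynomial (Fin 3) ℂ) (ht : X 2 ^ N * t ∈ Ideal.span {X 0 ^ N, X 1 ^ N}) :
      t ∈ Ideal.span {X 0 ^ N, X 1 ^ N} := by
    have := mem_span_X_pow_image_of_mul_mem (s := {0, 1}) (j := (2 : Fin 3)) (N := N) (t := t)
    simp only [Set.image_pair] at this
    exact this (by simp) ht
  have hX₀ : (X 0 : MvPolynomial (Fin 3) ℂ) ^ N ≠ 0 := pow_ne_zero N (X_ne_zero 0)
  set f : Fin 3 → MvPolynomial (Fin 3) ℂ := fun i => pderiv i h with hf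
  have hfdeg (i : Fin 3) := hh.pderiv_int i
  have hPf (i j : Fin 3) (n : ℤ) (hn : n = (d - w i) + (d - w j)) :
      IsWeightedHomogeneous (fun i => (w i : ℤ)) (P i * f j) n :=
    hn ▸ (hPdeg i).mul (hfdeg j)
  -- The quotients `(P ⨯₃ f) i / h` may be taken homogeneous.
  have hq (i : Fin 3) : ∃ q, IsWeightedHomogeneous (fun i => (w i : ℤ)) q
      (d - w (i + 1) - w (i + 2) : ℤ) ∧ (P ⨯₃ f) i = h * q := by
    obtain ⟨q, hq⟩ := hP i
    refine ⟨_, weightedHomogeneousComponent_isWeightedHomogeneous _ q, ?_⟩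
    have hdeg : IsWeightedHomogeneous (fun i => (w i : ℤ)) ((P ⨯₃ f) i)
        (d + (d - w (i + 1) - w (i + 2)) : ℤ) := by
      fin_cases i <;> simp only [cross_apply, Fin.mk_one, Fin.reduceFinMk, Fin.zero_eta,
        Fin.isValue, Matrix.cons_val, Fin.reduceAdd, zero_add] <;> apply IsWeightedHomogeneous.sub
      all_goals exact hPf _ _ _ (by ring)
    rw [← hdeg.weightedHomogeneousComponent_same, hq,
      weightedHomogeneousComponent_mul_of_left hh.natCast, add_sub_cancel_left]
  choose q hqdeg hq using hq
  have hqf : q 0 * f 0 + q 1 * f 1 + q 2 * f 2 = 0 := by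
    refine mul_left_cancel₀ hh₀ ?_
    have h0 := hq 0
    have h1 := hq 1
    have h2 := hq 2
    simp only [cross_apply, Fin.isValue, Matrix.cons_val] at h0 h1 h2
    linear_combination -f 0 * h0 - f 1 * h1 - f 2 * h2
  obtain ⟨r, hr⟩ := exists_eq_crossProduct_of_dotProduct_eq_zero hX₀ (hN 0) (hN 1) (hN 2) reg1 reg2
    hqf
  have hq₀ (i : Fin 3) : q i = 0 := by
    rw [← (hqdeg i).weightedHomogeneousComponent_same, hr]
    fin_cases i <;> simp only [cross_apply, Fin.mk_one, Fin.reduceFinMk, Fin.zero_eta,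
        Fin.isValue, Matrix.cons_val, Fin.reduceAdd, zero_add, map_sub, hf]
    all_goals
      rw [weightedHomogeneousComponent_mul_of_left (hfdeg _),
        weightedHomogeneousComponent_mul_of_left (hfdeg _),
        weightedHomogeneousComponent_eq_zero_of_neg hwn,
        weightedHomogeneousComponent_eq_zero_of_neg hwn, mul_zero, mul_zero, sub_zero]
      · linarith [hwp 0, hwp 1, hwp 2]
      · linarith [hwp 0, hwp 1, hwp 2]
  obtain ⟨t, ht⟩ := exists_eq_smul_of_crossProduct_eq_zero (p := P) hX₀ (hN 0) (hN 1) reg1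
    (funext fun i => by rw [hq, hq₀, mul_zero, Pi.zero_apply])
  refine ⟨coeff 0 t, fun i => ?_⟩
  rw [← (hPdeg i).weightedHomogeneousComponent_same, ht, Pi.smul_apply, smul_eq_mul, mul_comm,
    weightedHomogeneousComponent_mul_of_left (hfdeg i), sub_self,
    weightedHomogeneousComponent_zero_of_pos hwp, mul_comm]

end WeightedHomogeneous

theorem homogeneous_poisson_bracket_is_jacobian
    (w : Fin 3 → ℕ) (hw : ∀ i, 1 ≤ w i)
    (h : MvPolynomial (Fin 3) ℂ) (d : ℕ)
    -- `h` is weighted homogeneous of degree `d` with respect to `w`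
    (hh : IsWeightedHomogeneous w h d)
    -- the hypersurface `h = 0` has isolated singularities
    (hsing : FiniteDimensional ℂ
      ((MvPolynomial (Fin 3) ℂ) ⧸
        Ideal.span (insert h (Set.range fun i => pderiv i h))))
    (br : (MvPolynomial (Fin 3) ℂ ⧸ Ideal.span {h}) →
      (MvPolynomial (Fin 3) ℂ ⧸ Ideal.span {h}) →
      (MvPolynomial (Fin 3) ℂ ⧸ Ideal.span {h}))
    (hbr : IsPoissonBracket br)
    -- the bracket is weighted homogeneous of degree `d - (w 0 + w 1 + w 2)`:
    -- whenever `F` is weighted homogeneous of degree `a` and `G` of degree `b`,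
    -- `{[F],[G]}` is the class of a weighted homogeneous polynomial of degree
    -- `a + b + d - (w 0 + w 1 + w 2)` (degrees taken in `ℤ`)
    (hhom : ∀ (a b : ℤ) (F G : MvPolynomial (Fin 3) ℂ),
      IsWeightedHomogeneous (fun i => (w i : ℤ)) F a →
      IsWeightedHomogeneous (fun i => (w i : ℤ)) G b →
      ∃ H : MvPolynomial (Fin 3) ℂ,
        IsWeightedHomogeneous (fun i => (w i : ℤ)) H
          (a + b + (d : ℤ) - ((w 0 : ℤ) + (w 1 : ℤ) + (w 2 : ℤ))) ∧
        br (Ideal.Quotient.mk (Ideal.span {h}) F) (Ideal.Quotient.mk (Ideal.span {h}) G) =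
          Ideal.Quotient.mk (Ideal.span {h}) H) :
    ∃ c : ℂ, ∀ F G : MvPolynomial (Fin 3) ℂ,
      br (Ideal.Quotient.mk (Ideal.span {h}) F) (Ideal.Quotient.mk (Ideal.span {h}) G) =
        Ideal.Quotient.mk (Ideal.span {h})
          (C c * (Matrix.of fun r s => pderiv s (![F, G, h] r)).det) := by
  rcases eq_or_ne d 0 with rfl | hd
  · have hh₀ := ne_zero_of_finiteDimensional_quotient hw hh hsing
    have hC : h = C (coeff 0 h) := by
      have := hh.natCast.weightedHomogeneousComponent_same
      rw [Nat.cast_zero, weightedHomogeneousComponent_zero_of_pos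
        fun i => by exact_mod_cast hw i] at this
      exact this.symm
    have : Subsingleton (MvPolynomial (Fin 3) ℂ ⧸ Ideal.span {h}) := by
      rw [Ideal.Quotient.subsingleton_iff, Ideal.span_singleton_eq_top, hC]
      exact (IsUnit.mk0 _ fun h0 => hh₀ (by rw [hC, h0, C_0])).map C
    exact ⟨0, fun F G => Subsingleton.elim _ _⟩
  have hX (i : Fin 3) := isWeightedHomogeneous_X ℂ (fun i => (w i : ℤ)) i
  choose P hPdeg hP using fun i : Fin 3 => hhom _ _ _ _ (hX (i + 1)) (hX (i + 2))
  have hjac := hbr.mk_mk_eq hP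
  have hdvd (G : MvPolynomial (Fin 3) ℂ) :
      h ∣ (Matrix.of ![fun s => pderiv s G, fun s => pderiv s h, P]).det := by
    rw [← Ideal.mem_span_singleton, ← Ideal.Quotient.eq_zero_iff_mem, ← hjac,
      Ideal.Quotient.eq_zero_iff_mem.mpr (Ideal.mem_span_singleton_self h)]
    simpa using hbr.2.1 1 (Ideal.Quotient.mk _ G) 0 0
  obtain ⟨c, hc⟩ := exists_eq_C_mul_pderiv_of_crossProduct_mem hw hh hsing hd (P := P)
    (fun i => by
      convert hPdeg i using 1
      fin_cases i <;> simp <;> ring)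
    (fun i => by
      have := hdvd (X i)
      rw [← dvd_neg]
      convert this using 1
      fin_cases i <;> simp [Matrix.det_fin_three, cross_apply, pderiv_X, Pi.single_apply] <;> ring)
  refine ⟨c, fun F G => ?_⟩
  rw [hjac]
  congr 1
  simp only [Matrix.det_fin_three, Matrix.of_apply, Matrix.cons_val, hc]
  ring
end
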